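/- Let d ≥ 3, g(x) = |x|^{2-d}, β > 0, and let V : ℝ^d → ℝ be continuous, such that ∫ exp(-(β/2) N V(x)) dx < ∞ for N large enough, and such that (1-α₀)V satisfies lim_{|x|→∞} ((1-α₀)V(x)/2 + g(x)) = +∞ for some α₀ > 0. Let H_N(x₁,...,x_N) = Σ_{i≠j} g(x_i - x_j) + N Σ_i V(x_i), let P_{N,β} be the probability measure on (ℝ^d)^N with density proportional to exp(-(β/2) H_N), and let Q_{N,β} be the push-forward of P_{N,β} under the empirical measure map (x₁,...,x_N) ↦ (1/N) Σ_i δ_{x_i}, a probability measure on the space P(ℝ^d) of probability measures with the weak topology. Then for every Borel set E ⊆ P(ℝ^d): -inf over the interior of E of (β/2)(I_V - min I_V) ≤ liminf_{N→∞} (1/N²) log Q_{N,β}(E) ≤ limsup_{N→∞} (1/N²) log Q_{N,β}(E) ≤ -inf over the closure of E of (β/2)(I_V - min I_V). -/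

import Mathlib

open MeasureTheory Filter Topology
open scoped ENNReal

noncomputable section

/-- The ambient Euclidean space `ℝ^d`. -/
abbrev Esp (d : ℕ) := EuclideanSpace ℝ (Fin d)

/-- The real-valued Coulomb kernel `g(x) = |x|^(2-d)` in dimension `d ≥ 3`. -/
def gC (d : ℕ) (x : Esp d) : ℝ := ‖x‖ ^ (2 - (d : ℝ))

/-- The [0,∞]-valued Coulomb kernel (equal to `+∞` at the origin). -/
def coulK (d : ℕ) (x : Esp d) : ℝ≥0∞ := (ENNReal.ofReal ‖x‖) ^ (2 - (d : ℝ))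

/-- The Coulomb interaction energy `∬ g(x-y) dμ(x) dμ(y) ∈ [0,∞]`. -/
def doubleEnergy (d : ℕ) (μ : Measure (Esp d)) : ℝ≥0∞ :=
  ∫⁻ p : Esp d × Esp d, coulK d (p.1 - p.2) ∂(μ.prod μ)

/-- Integral of a real-valued function against a measure, with values in the extended reals
(difference of the integrals of the positive and negative parts). -/
def eIntR {α : Type*} [MeasurableSpace α] (μ : Measure α) (f : α → ℝ) : EReal :=
  ((∫⁻ x, ENNReal.ofReal (f x) ∂μ : ℝ≥0∞) : EReal)
    - ((∫⁻ x, ENNReal.ofReal (- f x) ∂μ : ℝ≥0∞) : EReal)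

/-- The mean-field energy functional `I_V(μ) = ∬ g(x-y) dμ(x)dμ(y) + ∫ V dμ ∈ (-∞, +∞]`. -/
def IV (d : ℕ) (V : Esp d → ℝ) (μ : Measure (Esp d)) : EReal :=
  (doubleEnergy d μ : EReal) + eIntR μ V

/-- The `N`-point Hamiltonian `H_N(x₁,…,x_N) = Σ_{i≠j} g(x_i - x_j) + N Σ_i V(x_i)`. -/
def HN (d N : ℕ) (V : Esp d → ℝ) (X : Fin N → Esp d) : ℝ :=
  (∑ i, ∑ j, if i ≠ j then gC d (X i - X j) else 0) + N * ∑ i, V (X i)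

/-- The partition function `Z_{N,β} = ∫ exp(-(β/2) H_N) dX_N`. -/
def ZN (d N : ℕ) (β : ℝ) (V : Esp d → ℝ) : ℝ≥0∞ :=
  ∫⁻ X : Fin N → Esp d, ENNReal.ofReal (Real.exp (-(β / 2) * HN d N V X))

/-- The canonical Gibbs measure `dP_{N,β} = Z_{N,β}⁻¹ exp(-(β/2) H_N) dX_N`. -/
def gibbs (d N : ℕ) (β : ℝ) (V : Esp d → ℝ) : Measure (Fin N → Esp d) :=
  (ZN d N β V)⁻¹ •
    volume.withDensity (fun X => ENNReal.ofReal (Real.exp (-(β / 2) * HN d N V X)))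

/-- The empirical measure map `(x₁,…,x_N) ↦ (1/N) Σ_i δ_{x_i}`, valued in the space of
probability measures (junk value for `N = 0`). -/
def empMap (d N : ℕ) (X : Fin N → Esp d) : ProbabilityMeasure (Esp d) :=
  if h : N = 0 then ⟨Measure.dirac 0, by infer_instance⟩
  else
    ⟨(N : ℝ≥0∞)⁻¹ • ∑ i : Fin N, Measure.dirac (X i), by
      constructor
      simp only [Measure.smul_apply, smul_eq_mul, Measure.coe_finset_sum, Finset.sum_apply,
        Measure.dirac_apply_of_mem (Set.mem_univ _), Finset.sum_const, Finset.card_univ,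
        Fintype.card_fin, nsmul_eq_mul, mul_one]
      exact ENNReal.inv_mul_cancel (by exact_mod_cast h) (by simp)⟩

/-- Borel σ-algebra on the space of probability measures (with its weak topology). -/
instance (d : ℕ) : MeasurableSpace (ProbabilityMeasure (Esp d)) := borel _

/-- `Q_{N,β}`: the push-forward of the Gibbs measure by the empirical measure map; a measure
on the space `P(ℝ^d)` of probability measures equipped with the weak topology. -/
def QNbeta (d N : ℕ) (β : ℝ) (V : Esp d → ℝ) : Measure (ProbabilityMeasure (Esp d)) :=
  (gibbs d N β V).map (empMap d N)

/-- The normalized rate function `(β/2)(I_V - min I_V)`. -/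
def rateLDP (d : ℕ) (β : ℝ) (V : Esp d → ℝ) (ν : ProbabilityMeasure (Esp d)) : EReal :=
  ((β / 2 : ℝ) : EReal) *
    (IV d V (ν : Measure (Esp d)) - ⨅ ν' : ProbabilityMeasure (Esp d), IV d V (ν' : Measure (Esp d)))

instance (d : ℕ) : BorelSpace (ProbabilityMeasure (Esp d)) := ⟨rfl⟩

/-- The energy `∬ g(x-y) dμ dμ + ∫ W dμ ∈ [0,∞]` of a measure in a nonnegative potential `W`. -/
def energyPot (d : ℕ) (W : Esp d → ℝ) (μ : Measure (Esp d)) : ℝ≥0∞ :=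
  doubleEnergy d μ + ∫⁻ x, ENNReal.ofReal (W x) ∂μ

/-- The energy `energyPot` with the Coulomb kernel truncated at height `M`. -/
def truncEnergy (d : ℕ) (W : Esp d → ℝ) (M : ℕ) (μ : Measure (Esp d)) : ℝ≥0∞ :=
  (∫⁻ p : Esp d × Esp d, min (coulK d (p.1 - p.2)) M ∂(μ.prod μ))
    + ∫⁻ x, ENNReal.ofReal (W x) ∂μ

lemma continuous_coulK (d : ℕ) : Continuous (coulK d) :=
  (ENNReal.continuous_rpow_const).comp (ENNReal.continuous_ofReal.comp continuous_norm)

lemma measurable_coulK_sub (d : ℕ) :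
    Measurable fun p : Esp d × Esp d => coulK d (p.1 - p.2) :=
  ((continuous_coulK d).comp (continuous_fst.sub continuous_snd)).measurable

/-- The lower integral of a continuous bounded function depends continuously on the measure. -/
lemma continuous_lintegral_min {α : Type*} [TopologicalSpace α] [MeasurableSpace α]
    [OpensMeasurableSpace α] {f : α → ℝ≥0∞} (hf : Continuous f) (M : ℕ) :
    Continuous fun μ : ProbabilityMeasure α => ∫⁻ x, min (f x) M ∂(μ : Measure α) := by
  have hfin : ∀ x, min (f x) (M : ℝ≥0∞) ≠ ⊤ := fun x =>
    ne_top_of_le_ne_top (ENNReal.natCast_ne_top M) (min_le_right _ _)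
  have hc : Continuous fun x => (min (f x) (M : ℝ≥0∞)).toNNReal :=
    ENNReal.continuousOn_toNNReal.comp_continuous (hf.min continuous_const) hfin
  have hb : ∀ x y, dist (min (f x) (M : ℝ≥0∞)).toNNReal (min (f y) (M : ℝ≥0∞)).toNNReal ≤ M := by
    intro x y
    have h : ∀ z, (((min (f z) (M : ℝ≥0∞)).toNNReal : NNReal) : ℝ) ≤ M := by
      intro z
      have : (min (f z) (M : ℝ≥0∞)).toNNReal ≤ (M : NNReal) := by
        rw [← ENNReal.coe_le_coe, ENNReal.coe_toNNReal (hfin z)]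
        simp
      exact_mod_cast this
    rw [NNReal.dist_eq, abs_le]
    constructor <;>
      nlinarith [h x, h y, NNReal.coe_nonneg (min (f x) (M : ℝ≥0∞)).toNNReal,
        NNReal.coe_nonneg (min (f y) (M : ℝ≥0∞)).toNNReal]
  have := ProbabilityMeasure.continuous_lintegral_boundedContinuousFunction
    (BoundedContinuousFunction.mkOfBound ⟨_, hc⟩ M hb)
  refine this.congr fun μ => lintegral_congr fun x => ?_
  exact ENNReal.coe_toNNReal (hfin x)

lemma iSup_min_natCast (a : ℝ≥0∞) : ⨆ M : ℕ, min a (M : ℝ≥0∞) = a := by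
  rw [← inf_iSup_eq, ENNReal.iSup_natCast, inf_top_eq]

lemma lintegral_eq_iSup_min {α : Type*} [MeasurableSpace α] {f : α → ℝ≥0∞} (hf : Measurable f)
    (μ : Measure α) : ∫⁻ x, f x ∂μ = ⨆ M : ℕ, ∫⁻ x, min (f x) M ∂μ := by
  rw [← lintegral_iSup (fun M => hf.min measurable_const)]
  · simp_rw [iSup_min_natCast]
  · intro m n hmn x
    exact min_le_min_left _ (by exact_mod_cast hmn)

lemma lowerSemicontinuous_lintegral {α : Type*} [TopologicalSpace α] [MeasurableSpace α]
    [OpensMeasurableSpace α] {f : α → ℝ≥0∞} (hf : Continuous f) :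
    LowerSemicontinuous fun μ : ProbabilityMeasure α => ∫⁻ x, f x ∂(μ : Measure α) := by
  simp_rw [fun μ : ProbabilityMeasure α => lintegral_eq_iSup_min hf.measurable (μ : Measure α)]
  exact lowerSemicontinuous_iSup fun M => (continuous_lintegral_min hf M).lowerSemicontinuous

lemma continuous_prod_self (d : ℕ) :
    Continuous fun μ : ProbabilityMeasure (Esp d) => μ.prod μ :=
  ProbabilityMeasure.continuous_prod.comp (continuous_id.prodMk continuous_id)

lemma lowerSemicontinuous_truncEnergy (d : ℕ) {W : Esp d → ℝ} (hW : Continuous W) (M : ℕ) :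
    LowerSemicontinuous fun μ : ProbabilityMeasure (Esp d) => truncEnergy d W M μ := by
  have h1 : Continuous fun μ : ProbabilityMeasure (Esp d) =>
      ∫⁻ p : Esp d × Esp d, min (coulK d (p.1 - p.2)) M ∂((μ : Measure (Esp d)).prod μ) :=
    (continuous_lintegral_min
      ((continuous_coulK d).comp (continuous_fst.sub continuous_snd)) M).comp
      (continuous_prod_self d)
  exact h1.lowerSemicontinuous.add
    (lowerSemicontinuous_lintegral (ENNReal.continuous_ofReal.comp hW))

lemma iSup_truncEnergy (d : ℕ) (W : Esp d → ℝ) (μ : Measure (Esp d)) :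
    ⨆ M, truncEnergy d W M μ = energyPot d W μ := by
  unfold truncEnergy energyPot doubleEnergy
  rw [lintegral_eq_iSup_min (measurable_coulK_sub d), ENNReal.iSup_add]

lemma truncEnergy_mono (d : ℕ) (W : Esp d → ℝ) (μ : Measure (Esp d)) :
    Monotone fun M => truncEnergy d W M μ := by
  intro m n hmn
  exact add_le_add_left (lintegral_mono fun p => min_le_min_left _ (by exact_mod_cast hmn)) _

/-- The sublevel sets of `μ ↦ ∫ W dμ` are relatively compact for a confining potential `W`. -/
lemma isCompact_closure_lintegral_le {d : ℕ} {W : Esp d → ℝ}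
    (hlim : Tendsto W (cocompact (Esp d)) atTop) {a : ℝ≥0∞} (ha : a ≠ ⊤) (hW : Continuous W) :
    IsCompact (closure {μ : ProbabilityMeasure (Esp d) |
      ∫⁻ x, ENNReal.ofReal (W x) ∂(μ : Measure (Esp d)) ≤ a}) := by
  apply isCompact_closure_of_isTightMeasureSet
  rw [isTightMeasureSet_iff_exists_isCompact_measure_compl_le]
  intro ε hε
  wlog hε' : ε ≠ ⊤ generalizing ε
  · obtain ⟨K, hK, h⟩ := this 1 one_pos ENNReal.one_ne_top
    refine ⟨K, hK, fun μ hμ => (h μ hμ).trans ?_⟩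
    simp [not_ne_iff.1 hε']
  have hr : (a / ε + 1) ≠ ⊤ := by
    simp [ENNReal.div_eq_top, ha, hε.ne']
  have h := hlim.eventually (eventually_ge_atTop (a / ε + 1).toReal)
  rw [Filter.Eventually, mem_cocompact] at h
  obtain ⟨K, hK, hKs⟩ := h
  refine ⟨K, hK, ?_⟩
  rintro _ ⟨μ, hμ, rfl⟩
  have h0 : a / ε + 1 ≠ 0 := by simp
  calc (μ : Measure (Esp d)) Kᶜ
      ≤ (μ : Measure (Esp d)) {x | a / ε + 1 ≤ ENNReal.ofReal (W x)} := by
        refine measure_mono fun x hx => ?_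
        exact (ENNReal.le_ofReal_iff_toReal_le hr
          (le_trans ENNReal.toReal_nonneg (hKs hx))).2 (hKs hx)
    _ ≤ (∫⁻ x, ENNReal.ofReal (W x) ∂(μ : Measure (Esp d))) / (a / ε + 1) :=
        meas_ge_le_lintegral_div (ENNReal.continuous_ofReal.comp hW).aemeasurable h0 hr
    _ ≤ a / (a / ε + 1) := ENNReal.div_le_div_right hμ _
    _ ≤ ε := by
        refine ENNReal.div_le_of_le_mul' ?_
        rw [add_mul, ENNReal.div_mul_cancel hε.ne' hε']
        exact le_self_add

/-- Truncating the kernel high enough does not push the infimum of the energy over a closed set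
below a given level. -/
lemma exists_lt_truncEnergy {d : ℕ} {W : Esp d → ℝ} (hW : Continuous W)
    (hlim : Tendsto W (cocompact (Esp d)) atTop) {F : Set (ProbabilityMeasure (Esp d))}
    (hF : IsClosed F) {a : ℝ≥0∞} (ha : a ≠ ⊤)
    (h : ∀ μ ∈ F, a < energyPot d W (μ : Measure (Esp d))) :
    ∃ M : ℕ, ∀ μ ∈ F, a < truncEnergy d W M (μ : Measure (Esp d)) := by
  by_contra! hcon
  let t : ℕ → Set (ProbabilityMeasure (Esp d)) := fun M =>
    F ∩ {μ | truncEnergy d W M (μ : Measure (Esp d)) ≤ a}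
  have hclosed : ∀ M, IsClosed (t M) := fun M =>
    hF.inter ((lowerSemicontinuous_truncEnergy d hW M).isClosed_preimage a)
  have hcpt : IsCompact (t 0) :=
    (isCompact_closure_lintegral_le hlim ha hW).of_isClosed_subset (hclosed 0)
      fun μ hμ => subset_closure
        ((le_add_self.trans hμ.2 : ∫⁻ x, ENNReal.ofReal (W x) ∂(μ : Measure (Esp d)) ≤ a))
  obtain ⟨μ, hμ⟩ := IsCompact.nonempty_iInter_of_sequence_nonempty_isCompact_isClosed t
    (fun M μ hμ => ⟨hμ.1, (truncEnergy_mono d W _ (Nat.le_succ M)).trans hμ.2⟩)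
    (fun M => by obtain ⟨μ, h1, h2⟩ := hcon M; exact ⟨μ, h1, h2⟩) hcpt hclosed
  rw [Set.mem_iInter] at hμ
  refine (h μ (hμ 0).1).not_ge ?_
  rw [← iSup_truncEnergy]
  exact iSup_le fun M => (hμ M).2

lemma coulK_of_ne_zero {d : ℕ} {x : Esp d} (hx : x ≠ 0) : coulK d x = ENNReal.ofReal (gC d x) :=
  ENNReal.ofReal_rpow_of_pos (norm_pos_iff.2 hx)

lemma gC_nonneg (d : ℕ) (x : Esp d) : 0 ≤ gC d x := Real.rpow_nonneg (norm_nonneg x) _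

lemma toMeasure_empMap {d N : ℕ} (hN : N ≠ 0) (X : Fin N → Esp d) :
    (empMap d N X : Measure (Esp d)) = (N : ℝ≥0∞)⁻¹ • ∑ i : Fin N, Measure.dirac (X i) := by
  simp [empMap, hN]

lemma lintegral_empMap {d N : ℕ} (hN : N ≠ 0) (X : Fin N → Esp d) {f : Esp d → ℝ≥0∞}
    (hf : Measurable f) :
    ∫⁻ x, f x ∂(empMap d N X : Measure (Esp d)) = (N : ℝ≥0∞)⁻¹ * ∑ i, f (X i) := by
  rw [toMeasure_empMap hN, lintegral_smul_measure, lintegral_finsetSum_measure]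
  simp [lintegral_dirac' _ hf]

lemma lintegral_prod_empMap {d N : ℕ} (hN : N ≠ 0) (X : Fin N → Esp d)
    {f : Esp d × Esp d → ℝ≥0∞} (hf : Measurable f) :
    ∫⁻ p, f p ∂((empMap d N X : Measure (Esp d)).prod (empMap d N X : Measure (Esp d)))
      = (N : ℝ≥0∞)⁻¹ * ((N : ℝ≥0∞)⁻¹ * ∑ i, ∑ j, f (X i, X j)) := by
  rw [lintegral_prod _ hf.aemeasurable, lintegral_empMap hN X hf.lintegral_prod_right']
  have : ∀ i, ∫⁻ y, f (X i, y) ∂(empMap d N X : Measure (Esp d))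
      = (N : ℝ≥0∞)⁻¹ * ∑ j, f (X i, X j) := fun i =>
    lintegral_empMap hN X (hf.comp measurable_prodMk_left)
  simp_rw [this, Finset.mul_sum]

lemma HN_nonneg {d N : ℕ} {W : Esp d → ℝ} (hW : ∀ x, 0 ≤ W x) (X : Fin N → Esp d) :
    0 ≤ HN d N W X :=
  add_nonneg (Finset.sum_nonneg fun i _ => Finset.sum_nonneg fun j _ => by
    split_ifs
    exacts [gC_nonneg _ _, le_rfl])
    (mul_nonneg (Nat.cast_nonneg _) (Finset.sum_nonneg fun i _ => hW _))

lemma ofReal_HN {d N : ℕ} {W : Esp d → ℝ} (hW : ∀ x, 0 ≤ W x) (X : Fin N → Esp d) :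
    ENNReal.ofReal (HN d N W X) =
      (∑ i, ∑ j, if i ≠ j then ENNReal.ofReal (gC d (X i - X j)) else 0)
        + N * ∑ i, ENNReal.ofReal (W (X i)) := by
  have h0 : ∀ i j : Fin N, 0 ≤ (if i ≠ j then gC d (X i - X j) else 0) := fun i j => by
    split_ifs
    exacts [gC_nonneg _ _, le_rfl]
  unfold HN
  rw [ENNReal.ofReal_add (Finset.sum_nonneg fun i _ => Finset.sum_nonneg fun j _ => h0 i j)
    (mul_nonneg (Nat.cast_nonneg _) (Finset.sum_nonneg fun i _ => hW _)),
    ENNReal.ofReal_mul (Nat.cast_nonneg _), ENNReal.ofReal_natCast,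
    ENNReal.ofReal_sum_of_nonneg (fun i _ => Finset.sum_nonneg fun j _ => h0 i j),
    ENNReal.ofReal_sum_of_nonneg (fun i _ => hW _)]
  congr 1
  refine Finset.sum_congr rfl fun i _ => ?_
  rw [ENNReal.ofReal_sum_of_nonneg (fun j _ => h0 i j)]
  refine Finset.sum_congr rfl fun j _ => ?_
  split_ifs <;> simp

/-- The truncated energy of an empirical measure is controlled by the Hamiltonian, up to the
diagonal terms. -/
lemma sq_mul_truncEnergy_empMap_le {d N : ℕ} (hN : N ≠ 0) {W : Esp d → ℝ} (hWc : Continuous W)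
    (hW : ∀ x, 0 ≤ W x) (M : ℕ) {X : Fin N → Esp d} (hX : ∀ i j, i ≠ j → X i ≠ X j) :
    (N : ℝ≥0∞) ^ 2 * truncEnergy d W M (empMap d N X : Measure (Esp d))
      ≤ ENNReal.ofReal (HN d N W X) + N * M := by
  have hN0 : (N : ℝ≥0∞) ≠ 0 := by exact_mod_cast hN
  have hNt : (N : ℝ≥0∞) ≠ ⊤ := ENNReal.natCast_ne_top N
  have hc : ∀ s : ℝ≥0∞, (N : ℝ≥0∞) * ((N : ℝ≥0∞)⁻¹ * s) = s := fun s => by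
    rw [← mul_assoc, ENNReal.mul_inv_cancel hN0 hNt, one_mul]
  unfold truncEnergy
  rw [lintegral_prod_empMap hN X ((measurable_coulK_sub d).min measurable_const),
    lintegral_empMap hN X hWc.measurable.ennreal_ofReal, mul_add, sq,
    mul_assoc, mul_assoc, hc, hc, hc, ofReal_HN hW, add_right_comm]
  gcongr
  have hM : (N : ℝ≥0∞) * M = ∑ i : Fin N, ∑ j : Fin N, if i = j then (M : ℝ≥0∞) else 0 := by
    simp
  rw [hM, ← Finset.sum_add_distrib]
  refine Finset.sum_le_sum fun i _ => ?_
  rw [← Finset.sum_add_distrib]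
  refine Finset.sum_le_sum fun j _ => ?_
  by_cases hij : i = j
  · simp [hij]
  · simp only [ne_eq, hij, not_false_eq_true, if_true, if_false, add_zero]
    rw [← coulK_of_ne_zero (sub_ne_zero.2 (hX i j hij))]
    exact min_le_left _ _

lemma ae_injective_config (d N : ℕ) (hd : d ≠ 0) :
    ∀ᵐ X : Fin N → Esp d, ∀ i j, i ≠ j → X i ≠ X j := by
  have : NeZero d := ⟨hd⟩
  rw [ae_all_iff]; intro i
  rw [ae_all_iff]; intro j
  by_cases hij : i = j
  · simp [hij]
  let L : (Fin N → Esp d) →ₗ[ℝ] Esp d :=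
    (LinearMap.proj i : (Fin N → Esp d) →ₗ[ℝ] Esp d) - LinearMap.proj j
  have hL : LinearMap.ker L ≠ ⊤ := by
    intro h
    obtain ⟨v, hv⟩ := exists_ne (0 : Esp d)
    have : Pi.single i v ∈ LinearMap.ker L := h ▸ Submodule.mem_top
    rw [LinearMap.mem_ker] at this
    simp [L, Ne.symm hij] at this
    exact hv this
  have := Measure.addHaar_submodule (volume : Measure (Fin N → Esp d)) (LinearMap.ker L) hL
  rw [ae_iff]
  refine measure_mono_null (fun X hX => ?_) this
  simp only [not_forall, not_not, Set.mem_ofPred_eq] at hX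
  obtain ⟨-, hX⟩ := hX
  simp [L, hX]

/-- The unnormalized Gibbs weight of the configurations whose empirical measure lies in `F`. -/
def gibbsWeight (d N : ℕ) (β : ℝ) (W : Esp d → ℝ) (F : Set (ProbabilityMeasure (Esp d))) :
    ℝ≥0∞ :=
  ∫⁻ X in empMap d N ⁻¹' F, ENNReal.ofReal (Real.exp (-(β / 2) * HN d N W X))

lemma lintegral_exp_sum {d N : ℕ} {f : Esp d → ℝ} (hf : Continuous f)
    (hint : ∫⁻ x, ENNReal.ofReal (Real.exp (f x)) ≠ ⊤) :
    ∫⁻ X : Fin N → Esp d, ENNReal.ofReal (Real.exp (∑ i, f (X i)))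
      = (∫⁻ x, ENNReal.ofReal (Real.exp (f x))) ^ N := by
  have hi : Integrable fun x => Real.exp (f x) := by
    refine ⟨(Real.continuous_exp.comp hf).aestronglyMeasurable, ?_⟩
    rw [hasFiniteIntegral_iff_ofReal (ae_of_all _ fun x => (Real.exp_pos _).le)]
    exact hint.lt_top
  have hp : Integrable fun X : Fin N → Esp d => ∏ i, Real.exp (f (X i)) :=
    Integrable.fintype_prod fun _ => hi
  simp_rw [Real.exp_sum]
  rw [← ofReal_integral_eq_lintegral_ofReal hp
    (ae_of_all _ fun X => Finset.prod_nonneg fun i _ => (Real.exp_pos _).le),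
    ← ofReal_integral_eq_lintegral_ofReal hi (ae_of_all _ fun x => (Real.exp_pos _).le),
    integral_fintype_prod_volume_eq_pow fun x => Real.exp (f x), Fintype.card_fin,
    ENNReal.ofReal_pow (integral_nonneg fun x => (Real.exp_pos _).le)]

lemma continuous_empMap (d N : ℕ) : Continuous (empMap d N) := by
  rcases eq_or_ne N 0 with rfl | hN
  · exact continuous_of_const fun X Y => rfl
  rw [continuous_iff_continuousAt]
  intro X
  rw [ContinuousAt, ProbabilityMeasure.tendsto_iff_forall_lintegral_tendsto]
  intro f
  have hf : Continuous fun x => (f x : ℝ≥0∞) := ENNReal.continuous_coe.comp f.continuous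
  simp_rw [fun X => lintegral_empMap hN X hf.measurable]
  refine ENNReal.Tendsto.const_mul ?_ (Or.inr (by simp [hN]))
  exact tendsto_finsetSum _ fun i _ => (hf.comp (continuous_apply i)).tendsto X

/-- Pointwise lower bound on the Hamiltonian, keeping a share `N₀ Σ W(xᵢ)` of the potential. -/
lemma le_HN_of_le_truncEnergy {d N N₀ M : ℕ} (hN : N ≠ 0) (hN₀ : N₀ ≤ N) {W : Esp d → ℝ}
    (hWc : Continuous W) (hW : ∀ x, 0 ≤ W x) {a : ℝ} {X : Fin N → Esp d}
    (hX : ∀ i j, i ≠ j → X i ≠ X j)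
    (ha : ENNReal.ofReal a ≤ truncEnergy d W M (empMap d N X : Measure (Esp d))) :
    (1 - N₀ * (N : ℝ)⁻¹) * ((N : ℝ) ^ 2 * a - N * M) + N₀ * ∑ i, W (X i) ≤ HN d N W X := by
  have hNr : (0 : ℝ) < N := by exact_mod_cast Nat.pos_of_ne_zero hN
  have hN₀r : (N₀ : ℝ) ≤ N := by exact_mod_cast hN₀
  have h1 : (N : ℝ) ^ 2 * a ≤ HN d N W X + N * M := by
    have h2 : (N : ℝ≥0∞) ^ 2 * ENNReal.ofReal a ≤ ENNReal.ofReal (HN d N W X) + N * M :=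
      (mul_le_mul_right ha _).trans (sq_mul_truncEnergy_empMap_le hN hWc hW M hX)
    rw [← ENNReal.ofReal_natCast, ← ENNReal.ofReal_natCast, ← ENNReal.ofReal_pow hNr.le,
      ← ENNReal.ofReal_mul (by positivity), ← ENNReal.ofReal_mul (by positivity),
      ← ENNReal.ofReal_add (HN_nonneg hW X) (by positivity),
      ENNReal.ofReal_le_ofReal_iff (add_nonneg (HN_nonneg hW X) (by positivity))] at h2
    exact h2
  have hθ0 : 0 ≤ 1 - N₀ * (N : ℝ)⁻¹ := by
    rw [sub_nonneg, ← div_eq_mul_inv]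
    exact div_le_one_of_le₀ hN₀r hNr.le
  unfold HN at h1 ⊢
  have hS0 : 0 ≤ ∑ i, ∑ j, if i ≠ j then gC d (X i - X j) else 0 :=
    Finset.sum_nonneg fun i _ => Finset.sum_nonneg fun j _ => by
      split_ifs
      exacts [gC_nonneg _ _, le_rfl]
  generalize (∑ i, ∑ j, if i ≠ j then gC d (X i - X j) else 0) = S at *
  generalize ∑ i, W (X i) = T at *
  have h3 : (1 - N₀ * (N : ℝ)⁻¹) * ((N : ℝ) ^ 2 * a - N * M)
      ≤ (1 - N₀ * (N : ℝ)⁻¹) * (S + N * T) :=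
    mul_le_mul_of_nonneg_left (by linarith) hθ0
  have h4 : (1 - N₀ * (N : ℝ)⁻¹) * (S + N * T) = S + N * T - N₀ * T - N₀ * (N : ℝ)⁻¹ * S := by
    field_simp
    ring
  have h5 : 0 ≤ N₀ * (N : ℝ)⁻¹ * S := by positivity
  linarith

/-- Upper bound for the Gibbs weight of a closed set. -/
lemma eventually_gibbsWeight_le {d : ℕ} (hd : d ≠ 0) {β : ℝ} (hβ : 0 < β) {W : Esp d → ℝ}
    (hWc : Continuous W) (hW : ∀ x, 0 ≤ W x) (hlim : Tendsto W (cocompact (Esp d)) atTop) {N₀ : ℕ}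
    (hint : ∫⁻ x : Esp d, ENNReal.ofReal (Real.exp (-(β / 2) * N₀ * W x)) ≠ ⊤)
    {F : Set (ProbabilityMeasure (Esp d))} (hF : IsClosed F) {a : ℝ}
    (h : ∀ μ ∈ F, ENNReal.ofReal a < energyPot d W (μ : Measure (Esp d))) {ε : ℝ} (hε : 0 < ε) :
    ∀ᶠ N : ℕ in atTop, gibbsWeight d N β W F
      ≤ ENNReal.ofReal (Real.exp (-(N : ℝ) ^ 2 * (β / 2 * a - ε))) := by
  obtain ⟨M, hM⟩ := exists_lt_truncEnergy hWc hlim hF ENNReal.ofReal_ne_top h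
  set D : ℝ := max 1 (∫⁻ x : Esp d, ENNReal.ofReal (Real.exp (-(β / 2) * N₀ * W x))).toReal
  have hD : 1 ≤ D := le_max_left _ _
  have hDle : ∫⁻ x : Esp d, ENNReal.ofReal (Real.exp (-(β / 2) * N₀ * W x)) ≤ ENNReal.ofReal D :=
    (ENNReal.le_ofReal_iff_toReal_le hint (zero_le_one.trans hD)).2 (le_max_right _ _)
  have hlimit : Tendsto (fun N : ℕ => β / 2 * ((1 - N₀ * (N : ℝ)⁻¹) * (a - M * (N : ℝ)⁻¹))
      - Real.log D * (N : ℝ)⁻¹) atTop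
      (𝓝 (β / 2 * ((1 - N₀ * 0) * (a - M * 0)) - Real.log D * 0)) := by
    have hi : Tendsto (fun N : ℕ => (N : ℝ)⁻¹) atTop (𝓝 0) := tendsto_inv_atTop_nhds_zero_nat
    exact ((((hi.const_mul _).const_sub _).mul ((hi.const_mul _).const_sub _)).const_mul _).sub
      (hi.const_mul _)
  have hev := hlimit.eventually (lt_mem_nhds (a := β / 2 * a - ε) (by simpa using hε))
  filter_upwards [hev, eventually_ge_atTop N₀, eventually_gt_atTop 0] with N hN hN₀ hNpos
  set c : ℝ := (1 - N₀ * (N : ℝ)⁻¹) * ((N : ℝ) ^ 2 * a - N * M) with hc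
  have hpt : ∀ X : Fin N → Esp d, (∀ i j, i ≠ j → X i ≠ X j) → empMap d N X ∈ F →
      Real.exp (-(β / 2) * HN d N W X)
        ≤ Real.exp (-(β / 2) * c) * Real.exp (∑ i, -(β / 2) * N₀ * W (X i)) := by
    intro X hX hXF
    rw [← Real.exp_add, Real.exp_le_exp, ← Finset.mul_sum]
    have h1 := mul_le_mul_of_nonneg_left
      (le_HN_of_le_truncEnergy hNpos.ne' hN₀ hWc hW hX (hM _ hXF).le) (half_pos hβ).le
    rw [← hc] at h1
    linarith
  have step1 : gibbsWeight d N β W F ≤ ∫⁻ X : Fin N → Esp d,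
      ENNReal.ofReal (Real.exp (-(β / 2) * c)) *
        ENNReal.ofReal (Real.exp (∑ i, -(β / 2) * N₀ * W (X i))) := by
    refine le_trans (setLIntegral_mono_ae' ((continuous_empMap d N).measurable hF.measurableSet)
      ?_) (setLIntegral_le_lintegral _ _)
    filter_upwards [ae_injective_config d N hd] with X hX hXF
    rw [← ENNReal.ofReal_mul (Real.exp_pos _).le]
    exact ENNReal.ofReal_le_ofReal (hpt X hX hXF)
  rw [lintegral_const_mul' _ _ ENNReal.ofReal_ne_top,
    lintegral_exp_sum (f := fun x => -(β / 2) * N₀ * W x) (continuous_const.mul hWc) hint] at step1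
  have step2 : ENNReal.ofReal (Real.exp (-(β / 2) * c)) * ENNReal.ofReal D ^ N
      = ENNReal.ofReal (Real.exp (-(β / 2) * c + N * Real.log D)) := by
    rw [← ENNReal.ofReal_pow (zero_le_one.trans hD), ← ENNReal.ofReal_mul (Real.exp_pos _).le,
      Real.exp_add, Real.exp_nat_mul, Real.exp_log (one_pos.trans_le hD)]
  have step3 : -(β / 2) * c + N * Real.log D ≤ -(N : ℝ) ^ 2 * (β / 2 * a - ε) := by
    have h6 := mul_le_mul_of_nonneg_left hN.le (sq_nonneg (N : ℝ))
    have h7 : (N : ℝ) ^ 2 * (β / 2 * ((1 - N₀ * (N : ℝ)⁻¹) * (a - M * (N : ℝ)⁻¹))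
        - Real.log D * (N : ℝ)⁻¹) = β / 2 * c - N * Real.log D := by
      rw [hc]; field_simp
    linarith
  refine step1.trans (le_trans ?_ (step2.trans_le
    (ENNReal.ofReal_le_ofReal (Real.exp_le_exp.2 step3))))
  exact mul_le_mul_right (pow_le_pow_left₀ zero_le hDle N) _

lemma pi_mono_measure {ι α : Type*} [Fintype ι] [MeasurableSpace α] {μ ν : Measure α}
    [SigmaFinite μ] [SigmaFinite ν] (h : μ ≤ ν) :
    Measure.pi (fun _ : ι => μ) ≤ Measure.pi fun _ : ι => ν := by
  refine Measure.le_iff.2 fun s hs => ?_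
  have h1 : (Measure.pi fun _ : ι => μ).toOuterMeasure
      ≤ OuterMeasure.pi fun _ : ι => ν.toOuterMeasure := by
    rw [OuterMeasure.le_pi]
    intro t _
    rw [Measure.toOuterMeasure_apply, Measure.pi_pi]
    exact Finset.prod_le_prod' fun i _ => h (t i)
  have h2 : (Measure.pi fun _ : ι => ν) s = OuterMeasure.pi (fun _ : ι => ν.toOuterMeasure) s := by
    rw [Measure.pi, toMeasure_apply _ _ hs]
  rw [h2]
  exact h1 s

lemma pi_smul_const {ι α : Type*} [Fintype ι] [MeasurableSpace α] (μ : Measure α)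
    [SigmaFinite μ] (c : NNReal) :
    Measure.pi (fun _ : ι => c • μ) = (c : ℝ≥0∞) ^ Fintype.card ι • Measure.pi fun _ : ι => μ := by
  refine Measure.pi_eq fun s _ => ?_
  simp only [Measure.smul_apply, Measure.pi_pi, smul_eq_mul, Measure.nnreal_smul_coe_apply]
  rw [Finset.prod_mul_distrib, Finset.prod_const, Finset.card_univ]

lemma variance_sum_eval_le {d N : ℕ} (ν : ProbabilityMeasure (Esp d))
    (f : BoundedContinuousFunction (Esp d) ℝ) {δ : ℝ} (hδ : 0 < δ) (hN : N ≠ 0) :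
    Measure.pi (fun _ : Fin N => (ν : Measure (Esp d)))
        {X | δ ≤ |∫ x, f x ∂(empMap d N X : Measure (Esp d)) - ∫ x, f x ∂(ν : Measure (Esp d))|}
      ≤ ENNReal.ofReal
        (ProbabilityTheory.variance f (ν : Measure (Esp d)) / δ ^ 2 * (N : ℝ)⁻¹) := by
  have hNr : (0 : ℝ) < N := by exact_mod_cast Nat.pos_of_ne_zero hN
  have hf : MemLp f 2 (ν : Measure (Esp d)) :=
    MemLp.of_bound f.continuous.aestronglyMeasurable ‖f‖ (ae_of_all _ f.norm_coe_le_norm)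
  have hmp := measurePreserving_eval (fun _ : Fin N => (ν : Measure (Esp d)))
  have hfe : ∀ i, MemLp (fun X : Fin N → Esp d => f (X i)) 2
      (Measure.pi fun _ : Fin N => (ν : Measure (Esp d))) := fun i =>
    hf.comp_measurePreserving (hmp i)
  have hY : MemLp (∑ i, fun X : Fin N → Esp d => f (X i)) 2
      (Measure.pi fun _ : Fin N => (ν : Measure (Esp d))) := memLp_finsetSum' _ fun i _ => hfe i
  have hE : ∫ X, (∑ i, fun X : Fin N → Esp d => f (X i)) X
      ∂(Measure.pi fun _ : Fin N => (ν : Measure (Esp d)))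
      = N * ∫ x, f x ∂(ν : Measure (Esp d)) := by
    simp only [Finset.sum_apply]
    rw [integral_finsetSum _ fun i _ => (hfe i).integrable one_le_two]
    have : ∀ i : Fin N, ∫ X, f (X i) ∂(Measure.pi fun _ : Fin N => (ν : Measure (Esp d)))
        = ∫ x, f x ∂(ν : Measure (Esp d)) := fun i => by
      have h := integral_map (f := f)
        (μ := Measure.pi fun _ : Fin N => (ν : Measure (Esp d))) (hmp i).measurable.aemeasurable
        f.continuous.stronglyMeasurable.aestronglyMeasurable
      rw [(hmp i).map_eq] at h
      exact h.symm
    simp [this]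
  have hch := ProbabilityTheory.meas_ge_le_variance_div_sq hY (mul_pos hNr hδ)
  rw [ProbabilityTheory.variance_sum_pi fun _ => hf, hE] at hch
  refine (measure_mono fun X hX => ?_).trans (hch.trans_eq ?_)
  · have hemp : ∫ x, f x ∂(empMap d N X : Measure (Esp d)) = (N : ℝ)⁻¹ * ∑ i, f (X i) := by
      rw [toMeasure_empMap hN, integral_smul_measure,
        integral_finsetSum_measure fun i _ => integrable_dirac (by simp)]
      simp [integral_dirac]
    simp only [Set.mem_ofPred_eq, Finset.sum_apply] at hX ⊢
    rw [hemp] at hX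
    calc N * δ ≤ N * |(N : ℝ)⁻¹ * ∑ i, f (X i) - ∫ x, f x ∂(ν : Measure (Esp d))| := by gcongr
      _ = |N * ((N : ℝ)⁻¹ * ∑ i, f (X i) - ∫ x, f x ∂(ν : Measure (Esp d)))| := by
        rw [abs_mul, abs_of_pos hNr]
      _ = _ := by rw [mul_sub, mul_inv_cancel_left₀ hNr.ne']
  · congr 1
    simp only [Finset.sum_const, Finset.card_univ, Fintype.card_fin, nsmul_eq_mul]
    field_simp

/-- Weak law of large numbers for empirical measures of i.i.d. samples. -/
lemma tendsto_pi_empMap_compl {d : ℕ} {ν : ProbabilityMeasure (Esp d)}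
    {U : Set (ProbabilityMeasure (Esp d))} (hU : U ∈ 𝓝 ν) :
    Tendsto (fun N : ℕ => Measure.pi (fun _ : Fin N => (ν : Measure (Esp d)))
      (empMap d N ⁻¹' Uᶜ)) atTop (𝓝 0) := by
  let 𝓕 : Filter (ProbabilityMeasure (Esp d)) :=
    { sets := {U | Tendsto (fun N : ℕ => Measure.pi (fun _ : Fin N => (ν : Measure (Esp d)))
        (empMap d N ⁻¹' Uᶜ)) atTop (𝓝 0)}
      univ_sets := by simp
      sets_of_superset := by
        intro s t hs hst
        exact tendsto_of_tendsto_of_tendsto_of_le_of_le tendsto_const_nhds hs (fun _ => zero_le)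
          fun N => measure_mono (Set.preimage_mono (Set.compl_subset_compl.2 hst))
      inter_sets := by
        intro s t hs ht
        have := Tendsto.add hs ht
        rw [add_zero] at this
        refine tendsto_of_tendsto_of_tendsto_of_le_of_le tendsto_const_nhds this (fun _ => zero_le)
          fun N => ?_
        rw [Set.compl_inter, Set.preimage_union]
        exact measure_union_le _ _ }
  suffices h : Tendsto id 𝓕 (𝓝 ν) from h hU
  rw [ProbabilityMeasure.tendsto_iff_forall_integral_tendsto]
  intro f
  rw [Metric.tendsto_nhds]
  intro δ hδ
  change Tendsto (fun N : ℕ => Measure.pi (fun _ : Fin N => (ν : Measure (Esp d)))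
    (empMap d N ⁻¹' _)) atTop (𝓝 0)
  have hlim : Tendsto (fun N : ℕ => ENNReal.ofReal
      (ProbabilityTheory.variance f (ν : Measure (Esp d)) / δ ^ 2 * (N : ℝ)⁻¹)) atTop (𝓝 0) := by
    have := ENNReal.tendsto_ofReal ((tendsto_inv_atTop_nhds_zero_nat (𝕜 := ℝ)).const_mul
      (ProbabilityTheory.variance f (ν : Measure (Esp d)) / δ ^ 2))
    simpa using this
  refine tendsto_of_tendsto_of_tendsto_of_le_of_le' tendsto_const_nhds hlim
    (Eventually.of_forall fun _ => zero_le) ?_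
  filter_upwards [eventually_ne_atTop 0] with N hN
  refine (measure_mono fun X hX => ?_).trans (variance_sum_eval_le ν f hδ hN)
  simpa [Real.dist_eq] using hX

lemma ofReal_gC_le_coulK (d : ℕ) (x : Esp d) : ENNReal.ofReal (gC d x) ≤ coulK d x := by
  rcases eq_or_ne x 0 with rfl | h
  · rcases eq_or_ne (2 - (d : ℝ)) 0 with h0 | h0
    · simp [gC, coulK, h0]
    · simp [gC, Real.zero_rpow h0]
  · exact (coulK_of_ne_zero h).ge

lemma lintegral_coulK_pair_pi {d N : ℕ} (ν : Measure (Esp d)) [IsProbabilityMeasure ν] {i j : Fin N}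
    (hij : i ≠ j) :
    ∫⁻ X, coulK d (X i - X j) ∂(Measure.pi fun _ : Fin N => ν) = doubleEnergy d ν := by
  have hmp := measurePreserving_eval (fun _ : Fin N => ν)
  have hind := (ProbabilityTheory.iIndepFun_pi (μ := fun _ : Fin N => ν)
    (X := fun _ x => x) fun _ => aemeasurable_id).indepFun hij
  have hmap := (ProbabilityTheory.indepFun_iff_map_prod_eq_prod_map_map
    (measurable_pi_apply i).aemeasurable (measurable_pi_apply j).aemeasurable).1 hind
  have hi : Measure.map (fun X : Fin N → Esp d => X i) (Measure.pi fun _ : Fin N => ν) = ν :=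
    (hmp i).map_eq
  have hj : Measure.map (fun X : Fin N → Esp d => X j) (Measure.pi fun _ : Fin N => ν) = ν :=
    (hmp j).map_eq
  rw [hi, hj] at hmap
  rw [doubleEnergy, ← hmap, lintegral_map (measurable_coulK_sub d)
    ((measurable_pi_apply i).prodMk (measurable_pi_apply j))]

/-- The expected Hamiltonian of i.i.d. particles is at most `N²` times the mean-field energy. -/
lemma lintegral_HN_pi_le {d N : ℕ} {W : Esp d → ℝ} (hWc : Continuous W) (hW : ∀ x, 0 ≤ W x)
    (ν : ProbabilityMeasure (Esp d)) :
    ∫⁻ X, ENNReal.ofReal (HN d N W X) ∂(Measure.pi fun _ : Fin N => (ν : Measure (Esp d)))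
      ≤ (N : ℝ≥0∞) ^ 2 * energyPot d W ν := by
  have hmp := measurePreserving_eval (fun _ : Fin N => (ν : Measure (Esp d)))
  have hWm : Measurable fun x => ENNReal.ofReal (W x) := hWc.measurable.ennreal_ofReal
  have hone : ∀ i : Fin N,
      ∫⁻ X, ENNReal.ofReal (W (X i)) ∂(Measure.pi fun _ : Fin N => (ν : Measure (Esp d)))
        = ∫⁻ x, ENNReal.ofReal (W x) ∂(ν : Measure (Esp d)) := fun i =>
    (hmp i).lintegral_comp hWm
  have hcm : ∀ i j : Fin N, Measurable fun X : Fin N → Esp d => coulK d (X i - X j) := by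
    intro i j
    have h : Continuous fun X : Fin N → Esp d => X i - X j :=
      (continuous_apply i).sub (continuous_apply j)
    exact ((continuous_coulK d).comp h).measurable
  have hpt : ∀ X : Fin N → Esp d, ENNReal.ofReal (HN d N W X) ≤
      (∑ i, ∑ j, if i ≠ j then coulK d (X i - X j) else 0)
        + N * ∑ i, ENNReal.ofReal (W (X i)) := by
    intro X
    rw [ofReal_HN hW]
    refine add_le_add (Finset.sum_le_sum fun i _ => Finset.sum_le_sum fun j _ => ?_) le_rfl
    split_ifs
    · exact ofReal_gC_le_coulK d _
    · exact le_rfl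
  refine (lintegral_mono hpt).trans ?_
  have hWi : ∀ i : Fin N, Measurable fun X : Fin N → Esp d => ENNReal.ofReal (W (X i)) :=
    fun i => (hWc.comp (continuous_apply i)).measurable.ennreal_ofReal
  have hcm' : ∀ i j : Fin N, Measurable fun X : Fin N → Esp d =>
      if i ≠ j then coulK d (X i - X j) else 0 := fun i j => by
    split_ifs
    exacts [hcm i j, measurable_const]
  have hWs : Measurable fun X : Fin N → Esp d => ∑ i, ENNReal.ofReal (W (X i)) :=
    Finset.measurable_fun_sum _ fun i _ => hWi i
  rw [lintegral_add_right _ (hWs.const_mul _), lintegral_const_mul _ hWs,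
    lintegral_finsetSum _ fun i _ => hWi i,
    lintegral_finsetSum _ fun i _ => Finset.measurable_fun_sum _ fun j _ => hcm' i j]
  simp_rw [hone]
  rw [energyPot, mul_add]
  refine add_le_add ?_ (by simp [sq, mul_assoc])
  have hc : (N : ℝ≥0∞) ^ 2 * doubleEnergy d ν = ∑ i : Fin N, ∑ j : Fin N, doubleEnergy d ν := by
    simp [sq, mul_assoc]
  rw [hc]
  refine Finset.sum_le_sum fun i _ => ?_
  rw [lintegral_finsetSum _ fun j _ => hcm' i j]
  refine Finset.sum_le_sum fun j _ => ?_
  by_cases hij : i = j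
  · simp [hij]
  · simp only [ne_eq, hij, not_false_eq_true, if_true]
    exact (lintegral_coulK_pair_pi (ν : Measure (Esp d)) hij).le

lemma measurable_HN {d N : ℕ} {W : Esp d → ℝ} (hWc : Continuous W) :
    Measurable fun X : Fin N → Esp d => HN d N W X := by
  have hg : ∀ i j : Fin N, Measurable fun X : Fin N → Esp d =>
      if i ≠ j then gC d (X i - X j) else 0 := fun i j => by
    split_ifs
    · have h : Continuous fun X : Fin N → Esp d => ‖X i - X j‖ :=
        ((continuous_apply i).sub (continuous_apply j)).norm
      exact h.measurable.pow_const _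
    · exact measurable_const
  have hWi : ∀ i : Fin N, Measurable fun X : Fin N → Esp d => W (X i) :=
    fun i => (hWc.comp (continuous_apply i)).measurable
  exact (Finset.measurable_fun_sum _ fun i _ => Finset.measurable_fun_sum _ fun j _ => hg i j).add
    ((Finset.measurable_fun_sum _ fun i _ => hWi i).const_mul _)

/-- With asymptotically positive probability, i.i.d. samples of `ν` have empirical measure in `U`
and Hamiltonian below `N² r`, for every `r` above the energy of `ν`. -/
lemma eventually_le_pi_good {d : ℕ} {W : Esp d → ℝ} (hWc : Continuous W) (hW : ∀ x, 0 ≤ W x)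
    {ν : ProbabilityMeasure (Esp d)} {U : Set (ProbabilityMeasure (Esp d))} (hU : U ∈ 𝓝 ν)
    (hJ : energyPot d W (ν : Measure (Esp d)) ≠ ⊤) {δ : ℝ} (hδ : 0 < δ) :
    ∃ q : ℝ, 0 < q ∧ ∀ᶠ N : ℕ in atTop, ENNReal.ofReal q ≤
      Measure.pi (fun _ : Fin N => (ν : Measure (Esp d))) (empMap d N ⁻¹' U ∩
        {X | HN d N W X < (N : ℝ) ^ 2 * ((energyPot d W (ν : Measure (Esp d))).toReal + δ)}) := by
  set J := energyPot d W (ν : Measure (Esp d))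
  set j := J.toReal with hj
  have hj0 : 0 ≤ j := ENNReal.toReal_nonneg
  refine ⟨δ / (2 * (j + δ)), by positivity, ?_⟩
  have hq : 0 < ENNReal.ofReal (δ / (2 * (j + δ))) := ENNReal.ofReal_pos.2 (by positivity)
  filter_upwards [(tendsto_pi_empMap_compl hU).eventually (ge_mem_nhds hq),
    eventually_gt_atTop 0] with N hN hNpos
  have hNr : (0 : ℝ) < N := by exact_mod_cast hNpos
  set P := Measure.pi (fun _ : Fin N => (ν : Measure (Esp d))) with hP
  have hmarkov : P {X | ENNReal.ofReal ((N : ℝ) ^ 2 * (j + δ)) ≤ ENNReal.ofReal (HN d N W X)}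
      ≤ ENNReal.ofReal (j / (j + δ)) := by
    refine (meas_ge_le_lintegral_div (measurable_HN hWc).ennreal_ofReal.aemeasurable
      (ENNReal.ofReal_pos.2 (by positivity)).ne' ENNReal.ofReal_ne_top).trans ?_
    refine (ENNReal.div_le_div_right (lintegral_HN_pi_le hWc hW ν) _).trans_eq ?_
    have hJj : energyPot d W (ν : Measure (Esp d)) = ENNReal.ofReal j :=
      (ENNReal.ofReal_toReal hJ).symm
    rw [hJj, ← ENNReal.ofReal_natCast, ← ENNReal.ofReal_pow hNr.le,
      ← ENNReal.ofReal_mul (by positivity), ← ENNReal.ofReal_div_of_pos (by positivity)]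
    congr 1
    field_simp
  have hcover : (Set.univ : Set (Fin N → Esp d)) ⊆
      (empMap d N ⁻¹' U ∩ {X | HN d N W X < (N : ℝ) ^ 2 * (j + δ)}) ∪ (empMap d N ⁻¹' Uᶜ ∪
        {X | ENNReal.ofReal ((N : ℝ) ^ 2 * (j + δ)) ≤ ENNReal.ofReal (HN d N W X)}) := by
    intro X _
    by_cases h1 : empMap d N X ∈ U
    · by_cases h2 : HN d N W X < (N : ℝ) ^ 2 * (j + δ)
      · exact Or.inl ⟨h1, h2⟩
      · exact Or.inr (Or.inr (ENNReal.ofReal_le_ofReal (not_lt.1 h2)))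
    · exact Or.inr (Or.inl h1)
  have h1 : 1 ≤ P (empMap d N ⁻¹' U ∩ {X | HN d N W X < (N : ℝ) ^ 2 * (j + δ)})
      + (ENNReal.ofReal (δ / (2 * (j + δ))) + ENNReal.ofReal (j / (j + δ))) := by
    calc (1 : ℝ≥0∞) = P Set.univ := measure_univ.symm
      _ ≤ _ := (measure_mono hcover).trans ((measure_union_le _ _).trans
        (add_le_add le_rfl ((measure_union_le _ _).trans (add_le_add hN hmarkov))))
  have h2 : (1 : ℝ≥0∞) = ENNReal.ofReal (δ / (2 * (j + δ)))
      + (ENNReal.ofReal (δ / (2 * (j + δ))) + ENNReal.ofReal (j / (j + δ))) := by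
    rw [← ENNReal.ofReal_add (by positivity) (by positivity),
      ← ENNReal.ofReal_add (by positivity) (by positivity), ← ENNReal.ofReal_one]
    congr 1
    field_simp
    ring
  rw [h2] at h1
  exact (ENNReal.add_le_add_iff_right (by finiteness)).1 h1

/-- Lower bound for the Gibbs weight of a neighbourhood of a measure with bounded density. -/
lemma eventually_le_gibbsWeight_of_le_volume {d : ℕ} {β : ℝ} (hβ : 0 < β) {W : Esp d → ℝ}
    (hWc : Continuous W) (hW : ∀ x, 0 ≤ W x) {ν : ProbabilityMeasure (Esp d)} {K : NNReal}
    (hK : (ν : Measure (Esp d)) ≤ K • volume) {U : Set (ProbabilityMeasure (Esp d))}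
    (hU : IsOpen U) (hν : ν ∈ U) (hJ : energyPot d W (ν : Measure (Esp d)) ≠ ⊤) {ε : ℝ}
    (hε : 0 < ε) :
    ∀ᶠ N : ℕ in atTop, ENNReal.ofReal (Real.exp (-(N : ℝ) ^ 2 *
      (β / 2 * (energyPot d W (ν : Measure (Esp d))).toReal + ε))) ≤ gibbsWeight d N β W U := by
  obtain ⟨q, hq, hgood⟩ := eventually_le_pi_good hWc hW (hU.mem_nhds hν) hJ (div_pos hε hβ)
  set j := (energyPot d W (ν : Measure (Esp d))).toReal
  set L : ℝ := max K 1 with hL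
  have hL1 : 1 ≤ L := le_max_right _ _
  have hlim : Tendsto (fun N : ℕ => Real.log L * (N : ℝ)⁻¹ - Real.log q * ((N : ℝ)⁻¹ * (N : ℝ)⁻¹))
      atTop (𝓝 (Real.log L * 0 - Real.log q * (0 * 0))) := by
    have hi : Tendsto (fun N : ℕ => (N : ℝ)⁻¹) atTop (𝓝 0) := tendsto_inv_atTop_nhds_zero_nat
    exact (hi.const_mul _).sub ((hi.mul hi).const_mul _)
  have hev := hlim.eventually_lt_const (u := ε / 2) (by simpa using hε)
  filter_upwards [hgood, hev, eventually_gt_atTop 0] with N hN hNε hNpos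
  set P := Measure.pi (fun _ : Fin N => (ν : Measure (Esp d))) with hP
  set A := empMap d N ⁻¹' U ∩ {X | HN d N W X < (N : ℝ) ^ 2 * (j + ε / β)} with hA
  have hUm : MeasurableSet (empMap d N ⁻¹' U) := (continuous_empMap d N).measurable hU.measurableSet
  have hAm : MeasurableSet A := hUm.inter (measurableSet_lt (measurable_HN hWc) measurable_const)
  set w : ℝ := Real.exp (-(β / 2) * ((N : ℝ) ^ 2 * (j + ε / β))) with hw
  have hPle : P ≤ (ENNReal.ofReal L) ^ N • (volume : Measure (Fin N → Esp d)) := by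
    have h1 : P ≤ Measure.pi (fun _ : Fin N => K • (volume : Measure (Esp d))) :=
      pi_mono_measure hK
    rw [pi_smul_const, Fintype.card_fin, ← volume_pi] at h1
    refine h1.trans (Measure.le_iff.2 fun s _ => ?_)
    rw [Measure.smul_apply, Measure.smul_apply, smul_eq_mul, smul_eq_mul]
    refine mul_le_mul_left (pow_le_pow_left₀ zero_le ?_ N) _
    rw [← ENNReal.ofReal_coe_nnreal]
    exact ENNReal.ofReal_le_ofReal (le_max_left _ _)
  have h1 : ENNReal.ofReal w * ENNReal.ofReal q ≤ ENNReal.ofReal L ^ N * gibbsWeight d N β W U := by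
    calc ENNReal.ofReal w * ENNReal.ofReal q ≤ ENNReal.ofReal w * P A := by gcongr
      _ = ∫⁻ _ in A, ENNReal.ofReal w ∂P := (setLIntegral_const _ _).symm
      _ ≤ ∫⁻ X in A, ENNReal.ofReal (Real.exp (-(β / 2) * HN d N W X)) ∂P := by
          refine setLIntegral_mono' hAm fun X hX => ENNReal.ofReal_le_ofReal ?_
          have h2 : HN d N W X < (N : ℝ) ^ 2 * (j + ε / β) := hX.2
          refine Real.exp_le_exp.2 ?_
          nlinarith
      _ ≤ ∫⁻ X in empMap d N ⁻¹' U, ENNReal.ofReal (Real.exp (-(β / 2) * HN d N W X)) ∂P :=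
          lintegral_mono_set Set.inter_subset_left
      _ ≤ ∫⁻ X in empMap d N ⁻¹' U, ENNReal.ofReal (Real.exp (-(β / 2) * HN d N W X))
            ∂((ENNReal.ofReal L) ^ N • (volume : Measure (Fin N → Esp d))) :=
          lintegral_mono' (Measure.restrict_mono le_rfl hPle) le_rfl
      _ = ENNReal.ofReal L ^ N * gibbsWeight d N β W U := by
          rw [Measure.restrict_smul, lintegral_smul_measure, gibbsWeight, smul_eq_mul]
  have hLN : ENNReal.ofReal L ^ N ≠ 0 :=
    (ENNReal.pow_pos (ENNReal.ofReal_pos.2 (one_pos.trans_le hL1)) N).ne'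
  rw [← ENNReal.mul_le_mul_iff_right hLN (by finiteness)]
  refine le_trans ?_ h1
  rw [← ENNReal.ofReal_pow (zero_le_one.trans hL1), ← ENNReal.ofReal_mul (by positivity),
    ← ENNReal.ofReal_mul (Real.exp_pos _).le]
  refine ENNReal.ofReal_le_ofReal ?_
  rw [← Real.exp_log (one_pos.trans_le hL1), ← Real.exp_nat_mul, ← Real.exp_log hq,
    ← Real.exp_add, ← Real.exp_add, Real.exp_le_exp]
  have h2 := mul_le_mul_of_nonneg_left hNε.le (sq_nonneg (N : ℝ))
  have h3 : (N : ℝ) ^ 2 * (Real.log L * (N : ℝ)⁻¹ - Real.log q * ((N : ℝ)⁻¹ * (N : ℝ)⁻¹))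
      = N * Real.log L - Real.log q := by
    field_simp
  have h4 : β / 2 * ((N : ℝ) ^ 2 * (j + ε / β)) = (N : ℝ) ^ 2 * (β / 2 * j + ε / 2) := by
    field_simp
  nlinarith

lemma coulK_anti {d : ℕ} (hd : 2 ≤ d) {x y : Esp d} (h : ‖x‖ ≤ ‖y‖) : coulK d y ≤ coulK d x := by
  have hd' : (0 : ℝ) ≤ (d : ℝ) - 2 := sub_nonneg.2 (by exact_mod_cast hd)
  rw [coulK, coulK, ← neg_sub (d : ℝ), ENNReal.rpow_neg, ENNReal.rpow_neg, ENNReal.inv_le_inv]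
  exact ENNReal.rpow_le_rpow (ENNReal.ofReal_le_ofReal h) hd'

lemma coulK_smul {d : ℕ} {c : ℝ} (hc : 0 ≤ c) (x : Esp d) :
    coulK d (c • x) = ENNReal.ofReal c ^ (2 - (d : ℝ)) * coulK d x := by
  rw [coulK, coulK, norm_smul, Real.norm_of_nonneg hc, ENNReal.ofReal_mul hc,
    ENNReal.mul_rpow_of_ne_top ENNReal.ofReal_ne_top ENNReal.ofReal_ne_top]

lemma setLIntegral_coulK_ball_ne_top {d : ℕ} (hd : 3 ≤ d) (r : ℝ) :
    ∫⁻ x in Metric.ball (0 : Esp d) r, coulK d x ≠ ⊤ := by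
  have : Nonempty (Fin d) := ⟨⟨0, by omega⟩⟩
  have hdim : Module.finrank ℝ (Esp d) = d := finrank_euclideanSpace_fin
  have hint : IntegrableOn (fun x : Esp d => ‖x‖ ^ (2 - (d : ℝ))) (Metric.ball 0 r) := by
    rw [integrableOn_fun_norm_addHaar volume (f := fun t : ℝ => t ^ (2 - (d : ℝ))), hdim]
    refine IntegrableOn.congr_fun (f := fun t : ℝ => t) ?_ ?_ measurableSet_Ioo
    · exact (continuous_id.integrableOn_Icc).mono_set Set.Ioo_subset_Icc_self
    · intro t ht
      have ht0 : 0 < t := ht.1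
      simp only [smul_eq_mul]
      rw [← Real.rpow_natCast, ← Real.rpow_add ht0, Nat.cast_sub (by omega)]
      ring_nf
      simp
  have h := hint.lintegral_lt_top
  refine ne_of_lt ((lintegral_mono_ae ?_).trans_lt h)
  have h0 : ∀ᵐ x : Esp d, x ≠ 0 := by
    rw [ae_iff]
    simp
  filter_upwards [ae_restrict_of_ae h0] with x hx
  exact (coulK_of_ne_zero hx).le

/-- The uniform probability measure on the closed unit ball. -/
def unifBall (d : ℕ) : Measure (Esp d) := ProbabilityTheory.cond volume (Metric.closedBall 0 1)

instance (d : ℕ) : IsProbabilityMeasure (unifBall d) :=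
  ProbabilityTheory.cond_isProbabilityMeasure_of_finite
    (Metric.measure_closedBall_pos volume 0 one_pos).ne' measure_closedBall_lt_top.ne

lemma unifBall_le (d : ℕ) : ∃ c : NNReal, unifBall d ≤ c • volume := by
  have h0 := (Metric.measure_closedBall_pos volume (0 : Esp d) one_pos).ne'
  refine ⟨((volume (Metric.closedBall (0 : Esp d) 1))⁻¹).toNNReal, Measure.le_iff.2 fun s _ => ?_⟩
  rw [unifBall, ProbabilityTheory.cond_apply measurableSet_closedBall,
    Measure.smul_apply, ENNReal.smul_def, smul_eq_mul,
    ENNReal.coe_toNNReal (ENNReal.inv_ne_top.2 h0)]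
  gcongr
  exact Set.inter_subset_right

lemma ae_unifBall_norm_le (d : ℕ) : ∀ᵐ z ∂(unifBall d), ‖z‖ ≤ 1 := by
  have h : ∀ᵐ z ∂((volume : Measure (Esp d)).restrict (Metric.closedBall 0 1)), ‖z‖ ≤ 1 := by
    filter_upwards [ae_restrict_mem measurableSet_closedBall] with z hz
    simpa using hz
  exact Measure.ae_smul_measure h _

/-- Averaging the Coulomb kernel over a ball increases it by at most a constant factor. -/
lemma exists_lintegral_coulK_add_smul_le {d : ℕ} (hd : 3 ≤ d) : ∃ K : ℝ≥0∞, K ≠ ⊤ ∧ 1 ≤ K ∧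
    ∀ (u : Esp d) (ε : ℝ), 0 < ε →
      ∫⁻ z, coulK d (u + ε • z) ∂(unifBall d) ≤ K * coulK d u := by
  obtain ⟨c, hc⟩ := unifBall_le d
  set K₀ := ∫⁻ x in Metric.ball (0 : Esp d) 4, coulK d x with hK₀
  have hK₀top : K₀ ≠ ⊤ := setLIntegral_coulK_ball_ne_top hd 4
  set A : ℝ≥0∞ := ENNReal.ofReal (1 / 2) ^ (2 - (d : ℝ)) with hA
  have hA1 : 1 ≤ A := by
    refine ENNReal.one_le_rpow_of_pos_of_le_one_of_neg (ENNReal.ofReal_pos.2 (by norm_num))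
      (ENNReal.ofReal_le_one.2 (by norm_num)) ?_
    have : (3 : ℝ) ≤ d := by exact_mod_cast hd
    linarith
  refine ⟨A * (1 + c * K₀), by finiteness, ?_, fun u ε hε => ?_⟩
  · calc (1 : ℝ≥0∞) = 1 * 1 := (one_mul 1).symm
      _ ≤ A * (1 + c * K₀) := mul_le_mul' hA1 le_self_add
  have hhalf : coulK d ((1 / 2 : ℝ) • u) = A * coulK d u := coulK_smul (by norm_num) u
  have hnh : ‖(1 / 2 : ℝ) • u‖ = ‖u‖ / 2 := by
    rw [norm_smul]; norm_num; ring
  rcases le_total ε (‖u‖ / 2) with h | h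
  · calc ∫⁻ z, coulK d (u + ε • z) ∂(unifBall d) ≤ ∫⁻ _, A * coulK d u ∂(unifBall d) := by
          refine lintegral_mono_ae ?_
          filter_upwards [ae_unifBall_norm_le d] with z hz
          rw [← hhalf]
          refine coulK_anti (by omega) ?_
          have h1 : ‖ε • z‖ ≤ ε := by
            rw [norm_smul, Real.norm_of_nonneg hε.le]
            exact mul_le_of_le_one_right hε.le hz
          have h2 : ‖u‖ ≤ ‖u + ε • z‖ + ‖ε • z‖ := norm_le_add_norm_add _ _
          linarith
      _ = A * coulK d u := by simp
      _ ≤ A * (1 + c * K₀) * coulK d u := by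
          gcongr
          exact le_mul_of_one_le_right' le_self_add
  · have hu : ‖ε⁻¹ • u‖ ≤ 2 := by
      rw [norm_smul, Real.norm_of_nonneg (inv_pos.2 hε).le, inv_mul_le_iff₀ hε]
      linarith
    have hfac : ∀ z, coulK d (u + ε • z)
        = ENNReal.ofReal ε ^ (2 - (d : ℝ)) * coulK d (ε⁻¹ • u + z) := fun z => by
      rw [← coulK_smul hε.le, smul_add, smul_inv_smul₀ hε.ne']
    have hm : Measurable fun z => coulK d (ε⁻¹ • u + z) := by
      have h1 : Continuous fun z : Esp d => ε⁻¹ • u + z := by fun_prop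
      exact ((continuous_coulK d).comp h1).measurable
    have hbound : ∫⁻ z, coulK d (ε⁻¹ • u + z) ∂(unifBall d) ≤ c * K₀ := by
      have h1 : ∫⁻ z, coulK d (ε⁻¹ • u + z) ∂(unifBall d)
          ≤ ∫⁻ z, (Metric.ball (0 : Esp d) 4).indicator (coulK d) (ε⁻¹ • u + z) ∂(unifBall d) := by
        refine lintegral_mono_ae ?_
        filter_upwards [ae_unifBall_norm_le d] with z hz
        rw [Set.indicator_of_mem]
        rw [mem_ball_zero_iff]
        exact (norm_add_le _ _).trans_lt (by linarith)
      have h2 : ∫⁻ z, (Metric.ball (0 : Esp d) 4).indicator (coulK d) (ε⁻¹ • u + z) ∂(unifBall d)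
          ≤ ∫⁻ z, (Metric.ball (0 : Esp d) 4).indicator (coulK d) (ε⁻¹ • u + z) ∂(c • volume) :=
        lintegral_mono' hc le_rfl
      rw [lintegral_smul_measure,
        lintegral_add_left_eq_self (μ := volume) ((Metric.ball (0 : Esp d) 4).indicator (coulK d)),
        lintegral_indicator measurableSet_ball, ENNReal.smul_def, smul_eq_mul] at h2
      exact h1.trans h2
    have hε2 : ENNReal.ofReal ε ^ (2 - (d : ℝ)) ≤ A * coulK d u := by
      have hd' : (0 : ℝ) ≤ (d : ℝ) - 2 := sub_nonneg.2 (by exact_mod_cast (by omega : 2 ≤ d))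
      rw [← hhalf, coulK, hnh, ← neg_sub (d : ℝ), ENNReal.rpow_neg, ENNReal.rpow_neg,
        ENNReal.inv_le_inv]
      exact ENNReal.rpow_le_rpow (ENNReal.ofReal_le_ofReal h) hd'
    simp_rw [hfac]
    rw [lintegral_const_mul _ hm]
    calc _ ≤ A * coulK d u * (c * K₀) := mul_le_mul' hε2 hbound
      _ = A * (c * K₀) * coulK d u := by ring
      _ ≤ A * (1 + c * K₀) * coulK d u := by
          gcongr
          exact le_add_self

/-- The convolution of `μ` with the uniform probability measure on the ball of radius `ε`. -/
def mollify (d : ℕ) (ε : ℝ) (μ : Measure (Esp d)) : Measure (Esp d) :=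
  (μ.prod (unifBall d)).map fun p => p.1 + ε • p.2

lemma continuous_add_smul (d : ℕ) (ε : ℝ) :
    Continuous fun p : Esp d × Esp d => p.1 + ε • p.2 := by fun_prop

instance (d : ℕ) (ε : ℝ) (μ : Measure (Esp d)) [IsProbabilityMeasure μ] :
    IsProbabilityMeasure (mollify d ε μ) :=
  Measure.isProbabilityMeasure_map (continuous_add_smul d ε).measurable.aemeasurable

lemma lintegral_mollify {d : ℕ} {ε : ℝ} {μ : Measure (Esp d)} {f : Esp d → ℝ≥0∞}
    (hf : Measurable f) :
    ∫⁻ x, f x ∂(mollify d ε μ) = ∫⁻ p, f (p.1 + ε • p.2) ∂(μ.prod (unifBall d)) :=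
  lintegral_map hf (continuous_add_smul d ε).measurable

lemma mollify_le_volume {d : ℕ} {ε : ℝ} (hε : 0 < ε) (μ : Measure (Esp d))
    [IsProbabilityMeasure μ] : ∃ K : NNReal, mollify d ε μ ≤ K • volume := by
  obtain ⟨c, hc⟩ := unifBall_le d
  set b : ℝ≥0∞ := ENNReal.ofReal |(ε ^ Module.finrank ℝ (Esp d))⁻¹| with hb
  have hbtop : b ≠ ⊤ := ENNReal.ofReal_ne_top
  refine ⟨c * b.toNNReal, Measure.le_iff.2 fun s hs => ?_⟩
  have hm := (continuous_add_smul d ε).measurable hs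
  rw [mollify, Measure.map_apply (continuous_add_smul d ε).measurable hs, Measure.prod_apply hm]
  calc _ ≤ ∫⁻ _, c * (b * volume s) ∂μ := by
        refine lintegral_mono fun x => (hc _).trans_eq ?_
        rw [Measure.smul_apply, ENNReal.smul_def, smul_eq_mul]
        congr 1
        have h1 : Prod.mk x ⁻¹' ((fun p : Esp d × Esp d => p.1 + ε • p.2) ⁻¹' s)
            = (fun z : Esp d => ε • z) ⁻¹' ((fun z => x + z) ⁻¹' s) := rfl
        rw [h1, Measure.addHaar_preimage_smul _ hε.ne', measure_preimage_add]
    _ = _ := by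
        rw [lintegral_const, measure_univ, mul_one, Measure.smul_apply, ENNReal.smul_def,
          smul_eq_mul, ENNReal.coe_mul, ENNReal.coe_toNNReal hbtop, mul_assoc]

lemma tendsto_lintegral_mollify {d : ℕ} {μ : Measure (Esp d)} [IsProbabilityMeasure μ] {R : ℝ}
    (hR : ∀ᵐ x ∂μ, ‖x‖ ≤ R) {f : Esp d → ℝ≥0∞} (hf : Continuous f) {C : ℝ≥0∞} (hC : C ≠ ⊤)
    (hfC : ∀ x, ‖x‖ ≤ R + 1 → f x ≤ C) :
    Tendsto (fun n : ℕ => ∫⁻ x, f x ∂(mollify d (1 / ((n : ℝ) + 1)) μ)) atTop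
      (𝓝 (∫⁻ x, f x ∂μ)) := by
  have hlim : ∫⁻ x, f x ∂μ = ∫⁻ p : Esp d × Esp d, f p.1 ∂(μ.prod (unifBall d)) := by
    rw [lintegral_prod _ (by fun_prop)]
    simp
  simp_rw [hlim, lintegral_mollify hf.measurable]
  refine tendsto_lintegral_of_dominated_convergence (fun _ => C)
    (fun n => (hf.comp (continuous_add_smul d _)).measurable) (fun n => ?_) ?_ ?_
  · have h1 : ∀ᵐ p : Esp d × Esp d ∂(μ.prod (unifBall d)), ‖p.1‖ ≤ R :=
      Measure.quasiMeasurePreserving_fst.ae hR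
    have h2 : ∀ᵐ p : Esp d × Esp d ∂(μ.prod (unifBall d)), ‖p.2‖ ≤ 1 :=
      Measure.quasiMeasurePreserving_snd.ae (ae_unifBall_norm_le d)
    filter_upwards [h1, h2] with p hp1 hp2
    refine hfC _ ((norm_add_le _ _).trans (add_le_add hp1 ?_))
    rw [norm_smul, Real.norm_of_nonneg (by positivity)]
    refine mul_le_one₀ ?_ (norm_nonneg _) hp2
    exact div_le_one_of_le₀ (by linarith [n.cast_nonneg (α := ℝ)]) (by positivity)
  · simpa using hC
  · refine ae_of_all _ fun p => ?_
    have h : Tendsto (fun n : ℕ => p.1 + (1 / ((n : ℝ) + 1)) • p.2) atTop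
        (𝓝 (p.1 + (0 : ℝ) • p.2)) :=
      (tendsto_one_div_add_atTop_nhds_zero_nat.smul_const p.2).const_add p.1
    rw [zero_smul, add_zero] at h
    exact (hf.tendsto _).comp h

lemma lintegral_coulK_unifBall_sub_le {d : ℕ} (hd : 2 ≤ d) {K : ℝ≥0∞} {ε : ℝ} (hε : 0 < ε)
    (hK : ∀ u : Esp d, ∫⁻ z, coulK d (u + ε • z) ∂(unifBall d) ≤ K * coulK d u) (x y : Esp d) :
    ∫⁻ z, ∫⁻ z', coulK d (x + ε • z - (y + ε • z')) ∂(unifBall d) ∂(unifBall d)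
      ≤ min (K * (K * coulK d (x - y)))
          (ENNReal.ofReal (‖x - y‖ - 2 * ε) ^ (2 - (d : ℝ))) := by
  have hcont : Continuous fun z : Esp d => coulK d (x - y + ε • z) := by
    have h : Continuous fun z : Esp d => x - y + ε • z := by fun_prop
    exact (continuous_coulK d).comp h
  refine le_min ?_ ?_
  · have hin : ∀ z, ∫⁻ z', coulK d (x + ε • z - (y + ε • z')) ∂(unifBall d)
        ≤ K * coulK d (x - y + ε • z) := fun z => by
      have h1 : ∀ z', coulK d (x + ε • z - (y + ε • z'))
          = coulK d (-(x - y + ε • z) + ε • z') := fun z' => by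
        rw [coulK, coulK, ← norm_neg]
        congr 3
        abel
      have h2 : coulK d (-(x - y + ε • z)) = coulK d (x - y + ε • z) := by
        rw [coulK, coulK, norm_neg]
      simp_rw [h1, ← h2]
      exact hK _
    refine (lintegral_mono hin).trans ?_
    rw [lintegral_const_mul _ hcont.measurable]
    exact mul_le_mul_right (hK _) _
  · have hd' : (0 : ℝ) ≤ (d : ℝ) - 2 := sub_nonneg.2 (by exact_mod_cast hd)
    have hb : ∀ᵐ z ∂(unifBall d), ∫⁻ z', coulK d (x + ε • z - (y + ε • z')) ∂(unifBall d)
        ≤ ENNReal.ofReal (‖x - y‖ - 2 * ε) ^ (2 - (d : ℝ)) := by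
      filter_upwards [ae_unifBall_norm_le d] with z hz
      have hb' : ∀ᵐ z' ∂(unifBall d), coulK d (x + ε • z - (y + ε • z'))
          ≤ ENNReal.ofReal (‖x - y‖ - 2 * ε) ^ (2 - (d : ℝ)) := by
        filter_upwards [ae_unifBall_norm_le d] with z' hz'
        rw [coulK, ← neg_sub (d : ℝ), ENNReal.rpow_neg, ENNReal.rpow_neg, ENNReal.inv_le_inv]
        refine ENNReal.rpow_le_rpow (ENNReal.ofReal_le_ofReal ?_) hd'
        have hsmul : ∀ w : Esp d, ‖w‖ ≤ 1 → ‖ε • w‖ ≤ ε := fun w hw => by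
          rw [norm_smul, Real.norm_of_nonneg hε.le]
          exact mul_le_of_le_one_right hε.le hw
        have h1 : x - y = (x + ε • z - (y + ε • z')) - ε • z + ε • z' := by abel
        have h2 := norm_add_le ((x + ε • z - (y + ε • z')) - ε • z) (ε • z')
        have h3 := norm_sub_le (x + ε • z - (y + ε • z')) (ε • z)
        rw [← h1] at h2
        linarith [hsmul z hz, hsmul z' hz']
      exact (lintegral_mono_ae hb').trans_eq (by simp)
    exact (lintegral_mono_ae hb).trans_eq (by simp)

lemma measurable_min_coulK (d : ℕ) (K : ℝ≥0∞) (ε : ℝ) :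
    Measurable fun p : Esp d × Esp d => min (K * (K * coulK d (p.1 - p.2)))
      (ENNReal.ofReal (‖p.1 - p.2‖ - 2 * ε) ^ (2 - (d : ℝ))) := by
  have h1 : Measurable fun p : Esp d × Esp d => ‖p.1 - p.2‖ - 2 * ε := by fun_prop
  exact (((measurable_coulK_sub d).const_mul K).const_mul K).min
    (h1.ennreal_ofReal.pow_const _)

lemma doubleEnergy_mollify_le {d : ℕ} (hd : 2 ≤ d) {K : ℝ≥0∞} {ε : ℝ} (hε : 0 < ε)
    (hK : ∀ u : Esp d, ∫⁻ z, coulK d (u + ε • z) ∂(unifBall d) ≤ K * coulK d u)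
    (μ : Measure (Esp d)) [IsProbabilityMeasure μ] :
    doubleEnergy d (mollify d ε μ) ≤ ∫⁻ p : Esp d × Esp d, min (K * (K * coulK d (p.1 - p.2)))
          (ENNReal.ofReal (‖p.1 - p.2‖ - 2 * ε) ^ (2 - (d : ℝ))) ∂(μ.prod μ) := by
  have hT := (continuous_add_smul d ε).measurable
  have hcont : Continuous fun q : (Esp d × Esp d) × Esp d × Esp d =>
      coulK d (q.1.1 + ε • q.1.2 - (q.2.1 + ε • q.2.2)) := by
    have h : Continuous fun q : (Esp d × Esp d) × Esp d × Esp d =>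
      q.1.1 + ε • q.1.2 - (q.2.1 + ε • q.2.2) := by fun_prop
    exact (continuous_coulK d).comp h
  have hexp : doubleEnergy d (mollify d ε μ) = ∫⁻ x, ∫⁻ z, ∫⁻ y, ∫⁻ z',
      coulK d (x + ε • z - (y + ε • z')) ∂(unifBall d) ∂μ ∂(unifBall d) ∂μ := by
    rw [doubleEnergy, mollify, Measure.map_prod_map _ _ hT hT,
      lintegral_map (measurable_coulK_sub d) (hT.prodMap hT)]
    have h1 := lintegral_prod (μ := μ.prod (unifBall d)) (ν := μ.prod (unifBall d))
      (fun q => coulK d (q.1.1 + ε • q.1.2 - (q.2.1 + ε • q.2.2))) hcont.measurable.aemeasurable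
    refine h1.trans ?_
    rw [lintegral_prod _ hcont.measurable.lintegral_prod_right'.aemeasurable]
    refine lintegral_congr fun x => lintegral_congr fun z => ?_
    have h2 : Continuous fun q : Esp d × Esp d => coulK d (x + ε • z - (q.1 + ε • q.2)) := by
      have h : Continuous fun q : Esp d × Esp d => x + ε • z - (q.1 + ε • q.2) := by fun_prop
      exact (continuous_coulK d).comp h
    exact lintegral_prod _ h2.measurable.aemeasurable
  rw [hexp, lintegral_prod _ (measurable_min_coulK d K ε).aemeasurable]
  refine lintegral_mono fun x => ?_
  have hswap : ∫⁻ z, ∫⁻ y, ∫⁻ z', coulK d (x + ε • z - (y + ε • z')) ∂(unifBall d) ∂μ ∂(unifBall d)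
      = ∫⁻ y, ∫⁻ z, ∫⁻ z', coulK d (x + ε • z - (y + ε • z')) ∂(unifBall d) ∂(unifBall d) ∂μ := by
    refine lintegral_lintegral_swap ?_
    have h2 : Continuous fun q : (Esp d × Esp d) × Esp d =>
        coulK d (x + ε • q.1.1 - (q.1.2 + ε • q.2)) := by
      have h : Continuous fun q : (Esp d × Esp d) × Esp d =>
        x + ε • q.1.1 - (q.1.2 + ε • q.2) := by fun_prop
      exact (continuous_coulK d).comp h
    exact h2.measurable.lintegral_prod_right'.aemeasurable
  rw [hswap]
  exact lintegral_mono fun y => lintegral_coulK_unifBall_sub_le hd hε hK x y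

/-- An upper bound for the energies of the mollifications converging to the energy of `μ`. -/
lemma tendsto_lintegral_min_coulK {d : ℕ} {K : ℝ≥0∞} (hK1 : 1 ≤ K) (hK : K ≠ ⊤)
    {μ : Measure (Esp d)} [IsProbabilityMeasure μ] (hμ : doubleEnergy d μ ≠ ⊤) :
    Tendsto (fun n : ℕ => ∫⁻ p : Esp d × Esp d, min (K * (K * coulK d (p.1 - p.2)))
      (ENNReal.ofReal (‖p.1 - p.2‖ - 2 * (1 / ((n : ℝ) + 1))) ^ (2 - (d : ℝ))) ∂(μ.prod μ)) atTop
      (𝓝 (doubleEnergy d μ)) := by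
  refine tendsto_lintegral_of_dominated_convergence
    (fun p : Esp d × Esp d => K * (K * coulK d (p.1 - p.2)))
    (fun n => measurable_min_coulK d K _) (fun n => ae_of_all _ fun p => min_le_left _ _) ?_
    (ae_of_all _ fun p => ?_)
  · rw [lintegral_const_mul _ ((measurable_coulK_sub d).const_mul K),
      lintegral_const_mul _ (measurable_coulK_sub d)]
    exact ENNReal.mul_ne_top hK (ENNReal.mul_ne_top hK hμ)
  · have h1 : Tendsto (fun n : ℕ => ‖p.1 - p.2‖ - 2 * (1 / ((n : ℝ) + 1))) atTop
        (𝓝 (‖p.1 - p.2‖ - 2 * 0)) :=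
      (tendsto_one_div_add_atTop_nhds_zero_nat.const_mul 2).const_sub _
    rw [mul_zero, sub_zero] at h1
    have h2 := (ENNReal.continuous_rpow_const (y := 2 - (d : ℝ))).tendsto _ |>.comp
      (ENNReal.tendsto_ofReal h1)
    have h3 : min (K * (K * coulK d (p.1 - p.2))) (coulK d (p.1 - p.2)) = coulK d (p.1 - p.2) := by
      refine min_eq_right ?_
      calc coulK d (p.1 - p.2) ≤ K * coulK d (p.1 - p.2) := le_mul_of_one_le_left' hK1
        _ ≤ _ := le_mul_of_one_le_left' hK1
    have h4 := (tendsto_const_nhds (x := K * (K * coulK d (p.1 - p.2)))).min h2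
    rw [← coulK, h3] at h4
    exact h4

/-- A compactly supported measure of finite energy is approximated, weakly and in energy, by
measures with bounded density. -/
lemma exists_le_volume_of_bounded {d : ℕ} (hd : 3 ≤ d) {W : Esp d → ℝ} (hWc : Continuous W)
    {ν : ProbabilityMeasure (Esp d)} {R : ℝ} (hR : ∀ᵐ x ∂(ν : Measure (Esp d)), ‖x‖ ≤ R)
    {U : Set (ProbabilityMeasure (Esp d))} (hU : U ∈ 𝓝 ν) {b : ℝ≥0∞}
    (hb : energyPot d W (ν : Measure (Esp d)) < b) :
    ∃ ν' ∈ U, energyPot d W (ν' : Measure (Esp d)) < b ∧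
      ∃ K : NNReal, (ν' : Measure (Esp d)) ≤ K • volume := by
  obtain ⟨K, hKtop, hK1, hK⟩ := exists_lintegral_coulK_add_smul_le hd
  let ν' : ℕ → ProbabilityMeasure (Esp d) := fun n =>
    ⟨mollify d (1 / ((n : ℝ) + 1)) (ν : Measure (Esp d)), inferInstance⟩
  have hlim : Tendsto ν' atTop (𝓝 ν) := by
    rw [ProbabilityMeasure.tendsto_iff_forall_lintegral_tendsto]
    intro f
    refine tendsto_lintegral_mollify hR (C := ENNReal.ofNNReal (nndist f 0))
      (ENNReal.continuous_coe.comp f.continuous) ENNReal.coe_ne_top fun x _ => ?_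
    exact ENNReal.coe_le_coe.2 (BoundedContinuousFunction.NNReal.upper_bound f x)
  obtain ⟨C, hC⟩ := (isCompact_closedBall (0 : Esp d) (R + 1)).exists_bound_of_continuousOn
    hWc.continuousOn
  have hW : Tendsto (fun n => ∫⁻ x, ENNReal.ofReal (W x) ∂(ν' n : Measure (Esp d))) atTop
      (𝓝 (∫⁻ x, ENNReal.ofReal (W x) ∂(ν : Measure (Esp d)))) := by
    refine tendsto_lintegral_mollify hR (C := ENNReal.ofReal C)
      (ENNReal.continuous_ofReal.comp hWc) ENNReal.ofReal_ne_top fun x hx => ?_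
    exact ENNReal.ofReal_le_ofReal ((le_abs_self _).trans (hC x (by simpa using hx)))
  have hE := tendsto_lintegral_min_coulK hK1 hKtop (μ := (ν : Measure (Esp d)))
    (ne_top_of_lt (le_self_add.trans_lt hb))
  have hsum := (hE.add hW).eventually_lt_const hb
  obtain ⟨n, hnU, hn⟩ := ((hlim.eventually_mem hU).and hsum).exists
  have hpos : (0 : ℝ) < 1 / ((n : ℝ) + 1) := by positivity
  refine ⟨ν' n, hnU, lt_of_le_of_lt (add_le_add_left ?_ _) hn, mollify_le_volume hpos _⟩
  exact doubleEnergy_mollify_le (by omega) hpos (fun u => hK u _ hpos) _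

lemma energyPot_cond_le {d : ℕ} {W : Esp d → ℝ} (μ : Measure (Esp d)) [IsProbabilityMeasure μ]
    (s : Set (Esp d)) :
    energyPot d W (ProbabilityTheory.cond μ s) ≤ (μ s)⁻¹ * ((μ s)⁻¹ * energyPot d W μ) := by
  have h1 : 1 ≤ (μ s)⁻¹ := ENNReal.one_le_inv.2 prob_le_one
  have hle : ProbabilityTheory.cond μ s ≤ (μ s)⁻¹ • μ := Measure.le_iff.2 fun t _ => by
    rw [ProbabilityTheory.cond, Measure.smul_apply, Measure.smul_apply, smul_eq_mul, smul_eq_mul]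
    exact mul_le_mul_right (Measure.restrict_apply_le _ _) _
  rw [energyPot, energyPot, mul_add, mul_add]
  refine add_le_add ?_ ?_
  · rw [doubleEnergy, doubleEnergy, ProbabilityTheory.cond, Measure.prod_smul_left,
      Measure.prod_smul_right, lintegral_smul_measure, lintegral_smul_measure,
      Measure.prod_restrict, smul_eq_mul, smul_eq_mul]
    gcongr
    exact Measure.restrict_le_self
  · calc _ ≤ (μ s)⁻¹ * ∫⁻ x, ENNReal.ofReal (W x) ∂μ := by
          refine (lintegral_mono' hle le_rfl).trans_eq ?_
          rw [lintegral_smul_measure, smul_eq_mul]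
      _ ≤ _ := le_mul_of_one_le_left' h1

/-- A measure of finite energy is approximated, weakly and in energy, by measures with bounded
density. -/
lemma exists_le_volume_energyPot_lt {d : ℕ} (hd : 3 ≤ d) {W : Esp d → ℝ} (hWc : Continuous W)
    {ν : ProbabilityMeasure (Esp d)} {U : Set (ProbabilityMeasure (Esp d))} (hU : IsOpen U)
    (hν : ν ∈ U) {b : ℝ≥0∞} (hb : energyPot d W (ν : Measure (Esp d)) < b) :
    ∃ ν' ∈ U, energyPot d W (ν' : Measure (Esp d)) < b ∧
      ∃ K : NNReal, (ν' : Measure (Esp d)) ≤ K • volume := by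
  set B : ℕ → Set (Esp d) := fun n => Metric.closedBall 0 n with hB
  have hBmono : Monotone B := fun m n h => Metric.closedBall_subset_closedBall (by exact_mod_cast h)
  have hBun : ⋃ n, B n = Set.univ := Metric.iUnion_closedBall_nat 0
  have hm : Tendsto (fun n => (ν : Measure (Esp d)) (B n)) atTop (𝓝 1) := by
    have h := tendsto_measure_iUnion_atTop (μ := (ν : Measure (Esp d))) hBmono
    rwa [hBun, measure_univ] at h
  have hinv : Tendsto (fun n => ((ν : Measure (Esp d)) (B n))⁻¹) atTop (𝓝 1) := by
    simpa using hm.inv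
  obtain ⟨n₀, hn₀⟩ := eventually_atTop.1 (hm.eventually_ne one_ne_zero)
  let ν' : ℕ → ProbabilityMeasure (Esp d) := fun n =>
    ⟨ProbabilityTheory.cond (ν : Measure (Esp d)) (B (n + n₀)),
      ProbabilityTheory.cond_isProbabilityMeasure (hn₀ _ (Nat.le_add_left _ _))⟩
  have hinv' := (tendsto_add_atTop_iff_nat n₀).2 hinv
  have hlim : Tendsto ν' atTop (𝓝 ν) := by
    rw [ProbabilityMeasure.tendsto_iff_forall_lintegral_tendsto]
    intro f
    have h1 : Tendsto (fun n => ∫⁻ x in B n, f x ∂(ν : Measure (Esp d))) atTop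
        (𝓝 (∫⁻ x, f x ∂(ν : Measure (Esp d)))) := by
      have hfm : Measurable fun x => (f x : ℝ≥0∞) := by fun_prop
      have hind : ∀ n, ∫⁻ x in B n, f x ∂(ν : Measure (Esp d))
          = ∫⁻ x, (B n).indicator (fun x => (f x : ℝ≥0∞)) x ∂(ν : Measure (Esp d)) :=
        fun n => (lintegral_indicator measurableSet_closedBall _).symm
      simp_rw [hind]
      refine lintegral_tendsto_of_tendsto_of_monotone
        (fun n => (hfm.indicator measurableSet_closedBall).aemeasurable)
        (ae_of_all _ fun x m n h => Set.indicator_le_indicator_of_subset (hBmono h)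
          (fun _ => zero_le) x) (ae_of_all _ fun x => ?_)
      obtain ⟨m, hxm⟩ := Set.mem_iUnion.1 (hBun ▸ Set.mem_univ x : x ∈ ⋃ n, B n)
      refine tendsto_const_nhds.congr' ((eventually_ge_atTop m).mono fun n hn => ?_)
      exact (Set.indicator_of_mem (hBmono hn hxm) fun x => (f x : ℝ≥0∞)).symm
    have h2 := ENNReal.Tendsto.mul hinv' (Or.inl one_ne_zero)
      ((tendsto_add_atTop_iff_nat n₀).2 h1) (Or.inr ENNReal.one_ne_top)
    rw [one_mul] at h2
    refine h2.congr fun n => ?_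
    change _ = ∫⁻ x, f x ∂(ProbabilityTheory.cond (ν : Measure (Esp d)) (B (n + n₀)))
    rw [ProbabilityTheory.cond, lintegral_smul_measure, smul_eq_mul]
  have hE : Tendsto (fun n => ((ν : Measure (Esp d)) (B (n + n₀)))⁻¹ *
      (((ν : Measure (Esp d)) (B (n + n₀)))⁻¹ * energyPot d W (ν : Measure (Esp d)))) atTop
      (𝓝 (1 * (1 * energyPot d W (ν : Measure (Esp d))))) := by
    have hJ : energyPot d W (ν : Measure (Esp d)) ≠ ⊤ := ne_top_of_lt hb
    refine ENNReal.Tendsto.mul hinv' (Or.inl one_ne_zero) (ENNReal.Tendsto.mul_const hinv'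
      (Or.inr hJ)) (Or.inr ENNReal.one_ne_top)
  rw [one_mul, one_mul] at hE
  obtain ⟨n, hnU, hn⟩ :=
    ((hlim.eventually_mem (hU.mem_nhds hν)).and (hE.eventually_lt_const hb)).exists
  refine exists_le_volume_of_bounded hd hWc (ν := ν' n) (R := ((n + n₀ : ℕ) : ℝ)) ?_
    (hU.mem_nhds hnU) ((energyPot_cond_le _ _).trans_lt hn)
  have h : ∀ᵐ x ∂((ν : Measure (Esp d)).restrict (B (n + n₀))), ‖x‖ ≤ ((n + n₀ : ℕ) : ℝ) := by
    filter_upwards [ae_restrict_mem measurableSet_closedBall] with x hx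
    exact mem_closedBall_zero_iff.1 hx
  exact Measure.ae_smul_measure h _

/-- Lower bound for the Gibbs weight of an open set. -/
lemma eventually_le_gibbsWeight {d : ℕ} (hd : 3 ≤ d) {β : ℝ} (hβ : 0 < β) {W : Esp d → ℝ}
    (hWc : Continuous W) (hW : ∀ x, 0 ≤ W x) {U : Set (ProbabilityMeasure (Esp d))}
    (hU : IsOpen U) {ν : ProbabilityMeasure (Esp d)} (hν : ν ∈ U)
    (hJ : energyPot d W (ν : Measure (Esp d)) ≠ ⊤) {ε : ℝ} (hε : 0 < ε) :
    ∀ᶠ N : ℕ in atTop, ENNReal.ofReal (Real.exp (-(N : ℝ) ^ 2 *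
      (β / 2 * (energyPot d W (ν : Measure (Esp d))).toReal + ε))) ≤ gibbsWeight d N β W U := by
  set j := (energyPot d W (ν : Measure (Esp d))).toReal with hj
  have hb : energyPot d W (ν : Measure (Esp d)) < ENNReal.ofReal (j + ε / β) := by
    have hlt : j < j + ε / β := lt_add_of_pos_right _ (by positivity)
    exact (ENNReal.lt_ofReal_iff_toReal_lt hJ).2 hlt
  obtain ⟨ν', hν'U, hν', K, hK⟩ := exists_le_volume_energyPot_lt hd hWc hU hν hb
  have hJ' : energyPot d W (ν' : Measure (Esp d)) ≠ ⊤ := ne_top_of_lt hν'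
  have hle := (ENNReal.lt_ofReal_iff_toReal_lt hJ').1 hν'
  filter_upwards [eventually_le_gibbsWeight_of_le_volume hβ hWc hW hK hU hν'U hJ' (half_pos hε)]
    with N hN
  refine (ENNReal.ofReal_le_ofReal (Real.exp_le_exp.2 ?_)).trans hN
  have h1 : β / 2 * (energyPot d W (ν' : Measure (Esp d))).toReal + ε / 2 ≤ β / 2 * j + ε := by
    have h2 := mul_le_mul_of_nonneg_left hle.le (half_pos hβ).le
    have h3 : β / 2 * (j + ε / β) = β / 2 * j + ε / 2 := by field_simp
    linarith
  have := mul_le_mul_of_nonneg_left h1 (sq_nonneg (N : ℝ))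
  linarith

lemma exists_energyPot_ne_top {d : ℕ} (hd : 3 ≤ d) {W : Esp d → ℝ} (hWc : Continuous W) :
    ∃ ν : ProbabilityMeasure (Esp d), energyPot d W (ν : Measure (Esp d)) ≠ ⊤ := by
  obtain ⟨c, hc⟩ := unifBall_le d
  refine ⟨⟨unifBall d, inferInstance⟩, ENNReal.add_ne_top.2 ⟨?_, ?_⟩⟩
  · change doubleEnergy d (unifBall d) ≠ ⊤
    rw [doubleEnergy, lintegral_prod_symm _ (measurable_coulK_sub d).aemeasurable]
    have hb : ∀ᵐ y ∂(unifBall d), ∫⁻ x, coulK d (x - y) ∂(unifBall d)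
        ≤ c * ∫⁻ x in Metric.ball (0 : Esp d) 3, coulK d x := by
      filter_upwards [ae_unifBall_norm_le d] with y hy
      have h1 : ∫⁻ x, coulK d (x - y) ∂(unifBall d)
          ≤ ∫⁻ x, (Metric.ball (0 : Esp d) 3).indicator (coulK d) (x - y) ∂(unifBall d) := by
        refine lintegral_mono_ae ?_
        filter_upwards [ae_unifBall_norm_le d] with x hx
        rw [Set.indicator_of_mem]
        rw [mem_ball_zero_iff]
        exact (norm_sub_le _ _).trans_lt (by linarith)
      have h2 : ∫⁻ x, (Metric.ball (0 : Esp d) 3).indicator (coulK d) (x - y) ∂(unifBall d)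
          ≤ ∫⁻ x, (Metric.ball (0 : Esp d) 3).indicator (coulK d) (x - y) ∂(c • volume) :=
        lintegral_mono' hc le_rfl
      rw [lintegral_smul_measure,
        lintegral_sub_right_eq_self (μ := volume) ((Metric.ball (0 : Esp d) 3).indicator (coulK d)),
        lintegral_indicator measurableSet_ball, ENNReal.smul_def, smul_eq_mul] at h2
      exact h1.trans h2
    refine ne_top_of_le_ne_top ?_ (lintegral_mono_ae hb)
    have := setLIntegral_coulK_ball_ne_top hd 3
    simp only [lintegral_const, measure_univ, mul_one]
    finiteness
  · change ∫⁻ x, ENNReal.ofReal (W x) ∂(unifBall d) ≠ ⊤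
    obtain ⟨C, hC⟩ := (isCompact_closedBall (0 : Esp d) 1).exists_bound_of_continuousOn
      hWc.continuousOn
    have hb : ∀ᵐ x ∂(unifBall d), ENNReal.ofReal (W x) ≤ ENNReal.ofReal C := by
      filter_upwards [ae_unifBall_norm_le d] with x hx
      exact ENNReal.ofReal_le_ofReal ((le_abs_self _).trans (hC x (by simpa using hx)))
    refine ne_top_of_le_ne_top ?_ (lintegral_mono_ae hb)
    simp

lemma neBot_cocompact {d : ℕ} (hd : d ≠ 0) : (cocompact (Esp d)).NeBot := by
  have : Nonempty (Fin d) := ⟨⟨0, Nat.pos_of_ne_zero hd⟩⟩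
  have : NoncompactSpace (Esp d) := NormedSpace.noncompactSpace ℝ (Esp d)
  infer_instance

lemma volume_eq_top_of_mem_cocompact {d : ℕ} (hd : d ≠ 0) {s : Set (Esp d)}
    (hs : s ∈ cocompact (Esp d)) : volume s = ⊤ := by
  have : Nonempty (Fin d) := ⟨⟨0, Nat.pos_of_ne_zero hd⟩⟩
  have : NoncompactSpace (Esp d) := NormedSpace.noncompactSpace ℝ (Esp d)
  obtain ⟨t, ht, hts⟩ := mem_cocompact.1 hs
  have huniv : (volume : Measure (Esp d)) Set.univ = ⊤ :=
    measure_univ_of_isAddLeftInvariant _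
  have hcover : (Set.univ : Set (Esp d)) ⊆ t ∪ s := fun x _ =>
    or_iff_not_imp_left.2 fun hx => hts hx
  have h : (⊤ : ℝ≥0∞) ≤ volume t + volume s := by
    rw [← huniv]
    exact (measure_mono hcover).trans (measure_union_le _ _)
  by_contra hne
  exact (ENNReal.add_lt_top.2 ⟨ht.measure_lt_top, lt_top_iff_ne_top.2 hne⟩).not_ge h

/-- The growth and integrability assumptions force the potential to be confining. -/
lemma tendsto_potential_atTop {d : ℕ} (hd : 3 ≤ d) {β : ℝ} (hβ : 0 < β) {V : Esp d → ℝ}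
    (hVc : Continuous V) {N : ℕ}
    (hint : (∫⁻ x : Esp d, ENNReal.ofReal (Real.exp (-(β / 2) * N * V x))) ≠ ⊤)
    {α : ℝ} (hgrowth :
      Tendsto (fun x : Esp d => (1 - α) * V x / 2 + gC d x) (cocompact (Esp d)) atTop) :
    Tendsto V (cocompact (Esp d)) atTop := by
  have hd0 : d ≠ 0 := by omega
  have := neBot_cocompact hd0
  have hg : ∀ᶠ x in cocompact (Esp d), gC d x ≤ 1 := by
    filter_upwards [(tendsto_norm_cocompact_atTop (E := Esp d)).eventually_ge_atTop 1] with x hx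
    refine Real.rpow_le_one_of_one_le_of_nonpos hx ?_
    have : (3 : ℝ) ≤ d := by exact_mod_cast hd
    linarith
  have hV : Tendsto (fun x : Esp d => (1 - α) * V x) (cocompact (Esp d)) atTop := by
    refine tendsto_atTop.2 fun b => ?_
    filter_upwards [hg, hgrowth.eventually_ge_atTop (b / 2 + 1)] with x h1 h2
    linarith
  rcases lt_trichotomy (1 - α) 0 with h | h | h
  · exfalso
    have hneg : {x | V x ≤ 0} ∈ cocompact (Esp d) := by
      filter_upwards [hV.eventually_ge_atTop 0] with x hx
      exact nonpos_of_mul_nonneg_right hx h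
    refine hint (top_le_iff.1 ?_)
    rw [← volume_eq_top_of_mem_cocompact hd0 hneg]
    refine meas_le_lintegral₀ (by fun_prop) fun x hx => ENNReal.one_le_ofReal.2 ?_
    have hx' : V x ≤ 0 := hx
    refine Real.one_le_exp (mul_nonneg_of_nonpos_of_nonpos ?_ hx')
    have : 0 ≤ β / 2 * N := by positivity
    linarith
  · simp only [h, zero_mul] at hV
    exact absurd hV (not_tendsto_const_atTop _ _)
  · exact (tendsto_const_mul_atTop_of_pos h).1 hV

lemma HN_add_const {d N : ℕ} (V : Esp d → ℝ) (C : ℝ) (X : Fin N → Esp d) :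
    HN d N (fun x => V x + C) X = HN d N V X + (N : ℝ) ^ 2 * C := by
  simp only [HN, Finset.sum_add_distrib, Finset.sum_const, Finset.card_univ, Fintype.card_fin,
    nsmul_eq_mul]
  ring

lemma gibbsWeight_add_const {d N : ℕ} (β : ℝ) {V : Esp d → ℝ} (hV : Continuous V) (C : ℝ)
    (F : Set (ProbabilityMeasure (Esp d))) :
    gibbsWeight d N β (fun x => V x + C) F
      = ENNReal.ofReal (Real.exp (-(β / 2) * ((N : ℝ) ^ 2 * C))) * gibbsWeight d N β V F := by
  have hm : Measurable fun X : Fin N → Esp d =>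
      ENNReal.ofReal (Real.exp (-(β / 2) * HN d N V X)) :=
    ((measurable_HN hV).const_mul _).exp.ennreal_ofReal
  rw [gibbsWeight, gibbsWeight, ← lintegral_const_mul _ hm]
  refine lintegral_congr fun X => ?_
  rw [HN_add_const, mul_add, Real.exp_add, mul_comm, ENNReal.ofReal_mul (Real.exp_pos _).le]

lemma QNbeta_eq_gibbsWeight {d N : ℕ} {β : ℝ} {V : Esp d → ℝ} (hV : Continuous V) (C : ℝ)
    {E : Set (ProbabilityMeasure (Esp d))} (hE : MeasurableSet E) :
    QNbeta d N β V E = (gibbsWeight d N β (fun x => V x + C) Set.univ)⁻¹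
      * gibbsWeight d N β (fun x => V x + C) E := by
  have hem := (continuous_empMap d N).measurable
  have h1 : QNbeta d N β V E = (gibbsWeight d N β V Set.univ)⁻¹ * gibbsWeight d N β V E := by
    rw [QNbeta, Measure.map_apply hem hE, gibbs, Measure.smul_apply, smul_eq_mul,
      withDensity_apply _ (hem hE), gibbsWeight, gibbsWeight, Set.preimage_univ,
      Measure.restrict_univ, ZN]
  set t := ENNReal.ofReal (Real.exp (-(β / 2) * ((N : ℝ) ^ 2 * C))) with ht
  have ht0 : t ≠ 0 := (ENNReal.ofReal_pos.2 (Real.exp_pos _)).ne'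
  rw [h1, gibbsWeight_add_const β hV, gibbsWeight_add_const β hV, ← ht,
    ENNReal.mul_inv (Or.inl ht0) (Or.inl ENNReal.ofReal_ne_top), mul_mul_mul_comm,
    ENNReal.inv_mul_cancel ht0 ENNReal.ofReal_ne_top, one_mul]

lemma IV_eq_energyPot_sub {d : ℕ} {V : Esp d → ℝ} (hV : Continuous V) {C : ℝ} (hC : 0 ≤ C)
    (hVC : ∀ x, 0 ≤ V x + C) (μ : Measure (Esp d)) [IsProbabilityMeasure μ] :
    IV d V μ = (energyPot d (fun x => V x + C) μ : EReal) - (C : EReal) := by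
  have hneg : ∫⁻ x, ENNReal.ofReal (-V x) ∂μ ≤ ENNReal.ofReal C := by
    calc ∫⁻ x, ENNReal.ofReal (-V x) ∂μ ≤ ∫⁻ _, ENNReal.ofReal C ∂μ :=
          lintegral_mono fun x => ENNReal.ofReal_le_ofReal (by linarith [hVC x])
      _ = _ := by simp
  have hadd : ∫⁻ x, ENNReal.ofReal (V x + C) ∂μ + ∫⁻ x, ENNReal.ofReal (-V x) ∂μ
      = ∫⁻ x, ENNReal.ofReal (V x) ∂μ + ENNReal.ofReal C := by
    have h1 : ∀ x, ENNReal.ofReal (V x + C) + ENNReal.ofReal (-V x)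
        = ENNReal.ofReal (V x) + ENNReal.ofReal C := fun x => by
      rcases le_total 0 (V x) with h | h
      · rw [ENNReal.ofReal_of_nonpos (neg_nonpos.2 h), add_zero, ENNReal.ofReal_add h hC]
      · rw [ENNReal.ofReal_of_nonpos h, zero_add,
          ← ENNReal.ofReal_add (hVC x) (neg_nonneg.2 h)]
        congr 1
        ring
    rw [← lintegral_add_left (by fun_prop)]
    simp_rw [h1]
    rw [lintegral_add_left (by fun_prop)]
    simp
  have hnt : ∫⁻ x, ENNReal.ofReal (-V x) ∂μ ≠ ⊤ := ne_top_of_le_ne_top ENNReal.ofReal_ne_top hneg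
  rw [IV, eIntR, energyPot]
  generalize ∫⁻ x, ENNReal.ofReal (V x + C) ∂μ = w at *
  generalize ∫⁻ x, ENNReal.ofReal (-V x) ∂μ = n at *
  generalize ∫⁻ x, ENNReal.ofReal (V x) ∂μ = p at *
  lift n to NNReal using hnt
  have hC' : ((ENNReal.ofReal C : ℝ≥0∞) : EReal) = (C : EReal) := by
    rw [EReal.coe_ennreal_ofReal, max_eq_left hC]
  have hadd' : (w : EReal) + (n : ℝ) = p + (C : EReal) := by
    rw [← hC', ← EReal.coe_ennreal_add, ← hadd, EReal.coe_ennreal_add]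
    rfl
  have hp : (p : EReal) - (n : ℝ) = w - (C : EReal) := by
    rw [← EReal.add_sub_cancel_right (a := (p : EReal)) (b := C), ← hadd', sub_eq_add_neg,
      sub_eq_add_neg, sub_eq_add_neg, add_right_comm, add_assoc (w : EReal),
      ← sub_eq_add_neg ((n : ℝ) : EReal)]
    rw [← EReal.coe_sub, sub_self, EReal.coe_zero, add_zero]
  change (doubleEnergy d μ : EReal) + ((p : EReal) - (n : ℝ)) = _
  rw [hp, EReal.coe_ennreal_add, sub_eq_add_neg, sub_eq_add_neg, add_assoc]

lemma iInf_IV_eq {d : ℕ} (hd : 3 ≤ d) {V : Esp d → ℝ} (hV : Continuous V) {C : ℝ} (hC : 0 ≤ C)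
    (hVC : ∀ x, 0 ≤ V x + C) :
    ⨅ ν : ProbabilityMeasure (Esp d), IV d V (ν : Measure (Esp d))
      = (((⨅ ν : ProbabilityMeasure (Esp d), energyPot d (fun x => V x + C)
          (ν : Measure (Esp d))).toReal - C : ℝ) : EReal) := by
  set J := fun ν : ProbabilityMeasure (Esp d) =>
    energyPot d (fun x => V x + C) (ν : Measure (Esp d))
  obtain ⟨ν₀, hν₀⟩ := exists_energyPot_ne_top hd (W := fun x => V x + C) (hV.add continuous_const)
  have hm : ⨅ ν, J ν ≠ ⊤ := ne_top_of_le_ne_top hν₀ (iInf_le _ ν₀)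
  have hm' : ((⨅ ν, J ν : ℝ≥0∞) : EReal) = ((⨅ ν, J ν).toReal : EReal) := by
    rw [← EReal.coe_ennreal_toReal hm]
  refine iInf_eq_of_forall_ge_of_forall_gt_exists_lt (fun ν => ?_) fun w hw => ?_
  · rw [IV_eq_energyPot_sub hV hC hVC, EReal.coe_sub, ← hm']
    exact EReal.sub_le_sub (EReal.coe_ennreal_le_coe_ennreal_iff.2 (iInf_le _ ν)) le_rfl
  · obtain ⟨r, hr, hrw⟩ := EReal.lt_iff_exists_real_btwn.1 hw
    have hr' : (⨅ ν, J ν).toReal < r + C := by linarith [EReal.coe_lt_coe_iff.1 hr]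
    obtain ⟨ν, hν⟩ := iInf_lt_iff.1 ((ENNReal.lt_ofReal_iff_toReal_lt hm).2 hr')
    refine ⟨ν, lt_trans ?_ hrw⟩
    have hJ : J ν ≠ ⊤ := ne_top_of_lt hν
    have h1 : (J ν).toReal < r + C := (ENNReal.lt_ofReal_iff_toReal_lt hJ).1 hν
    rw [IV_eq_energyPot_sub hV hC hVC, ← EReal.coe_ennreal_toReal hJ, ← EReal.coe_sub,
      EReal.coe_lt_coe_iff]
    linarith

/-- The normalized rate function in terms of the energy for the shifted potential. -/
lemma rateLDP_eq {d : ℕ} (hd : 3 ≤ d) {β : ℝ} {V : Esp d → ℝ} (hV : Continuous V) {C : ℝ}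
    (hC : 0 ≤ C) (hVC : ∀ x, 0 ≤ V x + C) {ν : ProbabilityMeasure (Esp d)}
    (hν : energyPot d (fun x => V x + C) (ν : Measure (Esp d)) ≠ ⊤) :
    rateLDP d β V ν = ((β / 2 * ((energyPot d (fun x => V x + C) (ν : Measure (Esp d))).toReal -
      (⨅ ν' : ProbabilityMeasure (Esp d), energyPot d (fun x => V x + C)
        (ν' : Measure (Esp d))).toReal) : ℝ) : EReal) := by
  rw [rateLDP, iInf_IV_eq hd hV hC hVC, IV_eq_energyPot_sub hV hC hVC,
    ← EReal.coe_ennreal_toReal hν, ← EReal.coe_sub, ← EReal.coe_sub, ← EReal.coe_mul]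
  congr 2
  ring

lemma rateLDP_eq_top {d : ℕ} (hd : 3 ≤ d) {β : ℝ} (hβ : 0 < β) {V : Esp d → ℝ}
    (hV : Continuous V) {C : ℝ} (hC : 0 ≤ C) (hVC : ∀ x, 0 ≤ V x + C)
    {ν : ProbabilityMeasure (Esp d)}
    (hν : energyPot d (fun x => V x + C) (ν : Measure (Esp d)) = ⊤) :
    rateLDP d β V ν = ⊤ := by
  rw [rateLDP, iInf_IV_eq hd hV hC hVC, IV_eq_energyPot_sub hV hC hVC, hν,
    EReal.coe_ennreal_top, EReal.top_sub_coe, EReal.top_sub_coe,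
    EReal.coe_mul_top_of_pos (half_pos hβ)]

lemma le_inv_sq_mul_log {N : ℕ} (hN : N ≠ 0) {c : ℝ} {q : ℝ≥0∞}
    (h : ENNReal.ofReal (Real.exp (-(N : ℝ) ^ 2 * c)) ≤ q) :
    ((-c : ℝ) : EReal) ≤ ((((N : ℝ) ^ 2)⁻¹ : ℝ) : EReal) * ENNReal.log q := by
  have hN2 : (0 : ℝ) < (N : ℝ) ^ 2 := by positivity
  have h1 := mul_le_mul_of_nonneg_left (ENNReal.log_le_log h)
    (EReal.coe_nonneg.2 (inv_pos.2 hN2).le)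
  refine le_trans (le_of_eq ?_) h1
  rw [ENNReal.log_ofReal_of_pos (Real.exp_pos _), Real.log_exp, ← EReal.coe_mul]
  congr 1
  field_simp

lemma inv_sq_mul_log_le {N : ℕ} (hN : N ≠ 0) {c : ℝ} {q : ℝ≥0∞}
    (h : q ≤ ENNReal.ofReal (Real.exp (-(N : ℝ) ^ 2 * c))) :
    ((((N : ℝ) ^ 2)⁻¹ : ℝ) : EReal) * ENNReal.log q ≤ ((-c : ℝ) : EReal) := by
  have hN2 : (0 : ℝ) < (N : ℝ) ^ 2 := by positivity
  have h1 := mul_le_mul_of_nonneg_left (ENNReal.log_le_log h)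
    (EReal.coe_nonneg.2 (inv_pos.2 hN2).le)
  refine h1.trans (le_of_eq ?_)
  rw [ENNReal.log_ofReal_of_pos (Real.exp_pos _), Real.log_exp, ← EReal.coe_mul]
  congr 1
  field_simp

lemma ofReal_exp_sub (x y : ℝ) : ENNReal.ofReal (Real.exp (x - y))
    = (ENNReal.ofReal (Real.exp y))⁻¹ * ENNReal.ofReal (Real.exp x) := by
  rw [← ENNReal.ofReal_inv_of_pos (Real.exp_pos _), ← Real.exp_neg,
    ← ENNReal.ofReal_mul (Real.exp_pos _).le, ← Real.exp_add, neg_add_eq_sub]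

lemma one_le_energyPot {d : ℕ} {W : Esp d → ℝ} (hW : ∀ x, 1 ≤ W x)
    (ν : ProbabilityMeasure (Esp d)) : 1 ≤ energyPot d W (ν : Measure (Esp d)) := by
  have h : ∫⁻ _, 1 ∂(ν : Measure (Esp d)) ≤ ∫⁻ x, ENNReal.ofReal (W x) ∂(ν : Measure (Esp d)) :=
    lintegral_mono fun x => ENNReal.one_le_ofReal.2 (hW x)
  rw [lintegral_one, measure_univ] at h
  exact h.trans le_add_self

/-- Lower bound for the normalized Gibbs weight of a neighbourhood of `ν`. -/
lemma eventually_le_normalized_gibbsWeight {d : ℕ} (hd : 3 ≤ d) {β : ℝ} (hβ : 0 < β)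
    {W : Esp d → ℝ} (hWc : Continuous W) (hW : ∀ x, 1 ≤ W x)
    (hlim : Tendsto W (cocompact (Esp d)) atTop) {N₀ : ℕ}
    (hint : ∫⁻ x : Esp d, ENNReal.ofReal (Real.exp (-(β / 2) * N₀ * W x)) ≠ ⊤)
    {U : Set (ProbabilityMeasure (Esp d))} (hU : IsOpen U) {ν : ProbabilityMeasure (Esp d)}
    (hν : ν ∈ U) (hJ : energyPot d W (ν : Measure (Esp d)) ≠ ⊤) {ε : ℝ} (hε : 0 < ε) :
    ∀ᶠ N : ℕ in atTop, ENNReal.ofReal (Real.exp (-(N : ℝ) ^ 2 *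
      (β / 2 * ((energyPot d W (ν : Measure (Esp d))).toReal
        - (⨅ ν' : ProbabilityMeasure (Esp d), energyPot d W (ν' : Measure (Esp d))).toReal) + ε)))
      ≤ (gibbsWeight d N β W Set.univ)⁻¹ * gibbsWeight d N β W U := by
  have hW0 : ∀ x, 0 ≤ W x := fun x => zero_le_one.trans (hW x)
  set m := (⨅ ν' : ProbabilityMeasure (Esp d), energyPot d W (ν' : Measure (Esp d))).toReal with hm
  set j := (energyPot d W (ν : Measure (Esp d))).toReal
  have hε3 : 0 < ε / 3 := by positivity
  have huniv : ∀ μ ∈ (Set.univ : Set (ProbabilityMeasure (Esp d))),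
      ENNReal.ofReal (m - 2 * (ε / 3) / β) < energyPot d W (μ : Measure (Esp d)) := fun μ _ => by
    rcases eq_or_ne (energyPot d W (μ : Measure (Esp d))) ⊤ with h | h
    · rw [h]; exact ENNReal.ofReal_lt_top
    · have h1 := one_le_energyPot hW μ
      have h2 : m ≤ (energyPot d W (μ : Measure (Esp d))).toReal :=
        ENNReal.toReal_mono h (iInf_le _ μ)
      rw [← ENNReal.ofReal_toReal h]
      refine (ENNReal.ofReal_lt_ofReal_iff
        (ENNReal.toReal_pos (one_pos.trans_le h1).ne' h)).2 ?_
      have : 0 < 2 * (ε / 3) / β := by positivity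
      linarith
  filter_upwards [eventually_gibbsWeight_le (by omega) hβ hWc hW0 hlim hint isClosed_univ huniv hε3,
    eventually_le_gibbsWeight hd hβ hWc hW0 hU hν hJ hε3] with N h1 h2
  have h3 := mul_le_mul' (ENNReal.inv_le_inv.2 h1) h2
  rw [← ofReal_exp_sub] at h3
  refine le_trans (ENNReal.ofReal_le_ofReal (Real.exp_le_exp.2 (le_of_eq ?_))) h3
  field_simp
  ring

/-- Upper bound for the normalized Gibbs weight of a closed set. -/
lemma eventually_normalized_gibbsWeight_le {d : ℕ} (hd : 3 ≤ d) {β : ℝ} (hβ : 0 < β)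
    {W : Esp d → ℝ} (hWc : Continuous W) (hW : ∀ x, 0 ≤ W x)
    (hlim : Tendsto W (cocompact (Esp d)) atTop) {N₀ : ℕ}
    (hint : ∫⁻ x : Esp d, ENNReal.ofReal (Real.exp (-(β / 2) * N₀ * W x)) ≠ ⊤)
    {F : Set (ProbabilityMeasure (Esp d))} (hF : IsClosed F) {a : ℝ}
    (h : ∀ μ ∈ F, ENNReal.ofReal a < energyPot d W (μ : Measure (Esp d))) {ε : ℝ} (hε : 0 < ε) :
    ∀ᶠ N : ℕ in atTop, (gibbsWeight d N β W Set.univ)⁻¹ * gibbsWeight d N β W F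
      ≤ ENNReal.ofReal (Real.exp (-(N : ℝ) ^ 2 * (β / 2 * (a -
        (⨅ ν' : ProbabilityMeasure (Esp d), energyPot d W (ν' : Measure (Esp d))).toReal)
          - ε))) := by
  obtain ⟨ν₀, hν₀⟩ := exists_energyPot_ne_top hd hWc
  have hmt : ⨅ ν' : ProbabilityMeasure (Esp d), energyPot d W (ν' : Measure (Esp d)) ≠ ⊤ :=
    ne_top_of_le_ne_top hν₀ (iInf_le _ ν₀)
  set m := (⨅ ν' : ProbabilityMeasure (Esp d), energyPot d W (ν' : Measure (Esp d))).toReal with hm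
  have hε3 : 0 < ε / 3 := by positivity
  have hlt : m < m + 2 * (ε / 3) / β := lt_add_of_pos_right _ (by positivity)
  obtain ⟨ν, hν⟩ := iInf_lt_iff.1 ((ENNReal.lt_ofReal_iff_toReal_lt hmt).2 hlt)
  have hJ : energyPot d W (ν : Measure (Esp d)) ≠ ⊤ := ne_top_of_lt hν
  have hj := (ENNReal.lt_ofReal_iff_toReal_lt hJ).1 hν
  filter_upwards [eventually_gibbsWeight_le (by omega) hβ hWc hW hlim hint hF h hε3,
    eventually_le_gibbsWeight hd hβ hWc hW isOpen_univ (Set.mem_univ ν) hJ hε3] with N h1 h2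
  have h3 := mul_le_mul' (ENNReal.inv_le_inv.2 h2) h1
  rw [← ofReal_exp_sub] at h3
  refine h3.trans (ENNReal.ofReal_le_ofReal (Real.exp_le_exp.2 ?_))
  have h4 : β / 2 * (energyPot d W (ν : Measure (Esp d))).toReal ≤ β / 2 * m + ε / 3 := by
    refine (mul_le_mul_of_nonneg_left hj.le (half_pos hβ).le).trans_eq ?_
    field_simp
  have h5 := mul_le_mul_of_nonneg_left h4 (sq_nonneg (N : ℝ))
  linarith

/-- Large deviations principle at speed `N²` for the empirical measure of the
Coulomb gas in dimension `d ≥ 3`, with good rate function `(β/2)(I_V - min I_V)`. -/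
theorem statement_4 (d : ℕ) (hd : 3 ≤ d) (β : ℝ) (hβ : 0 < β) (V : Esp d → ℝ)
    (hV : Continuous V)
    (hint : ∃ N₀ : ℕ, ∀ N ≥ N₀,
      (∫⁻ x : Esp d, ENNReal.ofReal (Real.exp (-(β / 2) * N * V x))) ≠ ⊤)
    (hgrowth : ∃ α₀ : ℝ, 0 < α₀ ∧
      Tendsto (fun x : Esp d => (1 - α₀) * V x / 2 + gC d x) (cocompact (Esp d)) atTop)
    (E : Set (ProbabilityMeasure (Esp d))) (hE : MeasurableSet E) :
    - sInf (rateLDP d β V '' interior E)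
        ≤ liminf (fun N : ℕ =>
            ((((N : ℝ) ^ 2)⁻¹ : ℝ) : EReal) * ENNReal.log (QNbeta d N β V E)) atTop ∧
    liminf (fun N : ℕ =>
        ((((N : ℝ) ^ 2)⁻¹ : ℝ) : EReal) * ENNReal.log (QNbeta d N β V E)) atTop
      ≤ limsup (fun N : ℕ =>
          ((((N : ℝ) ^ 2)⁻¹ : ℝ) : EReal) * ENNReal.log (QNbeta d N β V E)) atTop ∧
    limsup (fun N : ℕ =>
        ((((N : ℝ) ^ 2)⁻¹ : ℝ) : EReal) * ENNReal.log (QNbeta d N β V E)) atTop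
      ≤ - sInf (rateLDP d β V '' closure E) := by
  obtain ⟨N₀, hN₀⟩ := hint
  obtain ⟨α, -, hα⟩ := hgrowth
  have hVlim : Tendsto V (cocompact (Esp d)) atTop :=
    tendsto_potential_atTop hd hβ hV (hN₀ N₀ le_rfl) hα
  obtain ⟨x₀, hx₀⟩ := hV.exists_forall_le hVlim
  set C : ℝ := |V x₀| + 1 with hCdef
  have hC : 0 ≤ C := by positivity
  have hVC1 : ∀ x, 1 ≤ V x + C := fun x => by linarith [hx₀ x, neg_abs_le (V x₀)]
  have hVC : ∀ x, 0 ≤ V x + C := fun x => zero_le_one.trans (hVC1 x)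
  have hWc : Continuous fun x => V x + C := hV.add continuous_const
  have hWlim : Tendsto (fun x => V x + C) (cocompact (Esp d)) atTop :=
    tendsto_atTop_add_const_right _ C hVlim
  have hWint : ∫⁻ x : Esp d, ENNReal.ofReal (Real.exp (-(β / 2) * N₀ * (V x + C))) ≠ ⊤ := by
    refine ne_top_of_le_ne_top (hN₀ N₀ le_rfl)
      (lintegral_mono fun x => ENNReal.ofReal_le_ofReal (Real.exp_le_exp.2 ?_))
    have : 0 ≤ β / 2 * N₀ * C := by positivity
    linarith
  set m := (⨅ ν' : ProbabilityMeasure (Esp d), energyPot d (fun x => V x + C)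
    (ν' : Measure (Esp d))).toReal with hm
  refine ⟨?_, liminf_le_limsup, ?_⟩
  · rw [EReal.neg_le]
    refine le_sInf ?_
    rintro _ ⟨ν, hν, rfl⟩
    rw [EReal.neg_le]
    by_cases hJ : energyPot d (fun x => V x + C) (ν : Measure (Esp d)) = ⊤
    · rw [rateLDP_eq_top hd hβ hV hC hVC hJ, EReal.neg_top]
      exact bot_le
    rw [rateLDP_eq hd hV hC hVC hJ, ← hm]
    refine le_of_forall_lt_imp_le_of_dense fun c hc => ?_
    obtain ⟨s, hcs, hs⟩ := EReal.lt_iff_exists_real_btwn.1 hc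
    rw [← EReal.coe_neg, EReal.coe_lt_coe_iff] at hs
    refine hcs.le.trans (le_liminf_of_le (by isBoundedDefault) ?_)
    filter_upwards [eventually_le_normalized_gibbsWeight hd hβ hWc hVC1 hWlim hWint isOpen_interior
      hν hJ (sub_pos.2 hs), eventually_ne_atTop 0] with N hN hN0
    rw [QNbeta_eq_gibbsWeight hV C hE]
    have hmono : gibbsWeight d N β (fun x => V x + C) (interior E)
        ≤ gibbsWeight d N β (fun x => V x + C) E :=
      lintegral_mono_set (Set.preimage_mono interior_subset)
    have h1 := le_inv_sq_mul_log hN0 (hN.trans (mul_le_mul_right hmono _))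
    refine le_trans (EReal.coe_le_coe_iff.2 (le_of_eq ?_)) h1
    ring
  · rw [EReal.le_neg]
    refine le_of_forall_lt_imp_le_of_dense fun c hc => ?_
    obtain ⟨s, hcs, hs⟩ := EReal.lt_iff_exists_real_btwn.1 hc
    obtain ⟨t, hst, ht⟩ := EReal.lt_iff_exists_real_btwn.1 hs
    rw [EReal.coe_lt_coe_iff] at hst
    refine hcs.le.trans ?_
    rw [EReal.le_neg, ← EReal.coe_neg]
    have hF : ∀ μ ∈ closure E, ENNReal.ofReal (m + 2 * t / β)
        < energyPot d (fun x => V x + C) (μ : Measure (Esp d)) := fun μ hμ => by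
      by_cases hJ : energyPot d (fun x => V x + C) (μ : Measure (Esp d)) = ⊤
      · rw [hJ]; exact ENNReal.ofReal_lt_top
      have h1 : (t : EReal) < rateLDP d β V μ := ht.trans_le (sInf_le ⟨μ, hμ, rfl⟩)
      rw [rateLDP_eq hd hV hC hVC hJ, ← hm, EReal.coe_lt_coe_iff] at h1
      have h2 := one_le_energyPot hVC1 μ
      rw [← ENNReal.ofReal_toReal hJ]
      refine (ENNReal.ofReal_lt_ofReal_iff
        (ENNReal.toReal_pos (one_pos.trans_le h2).ne' hJ)).2 ?_
      rw [← lt_sub_iff_add_lt', div_lt_iff₀ hβ]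
      linarith
    refine limsup_le_of_le (by isBoundedDefault) ?_
    filter_upwards [eventually_normalized_gibbsWeight_le hd hβ hWc hVC hWlim hWint isClosed_closure
      hF (sub_pos.2 hst), eventually_ne_atTop 0] with N hN hN0
    rw [QNbeta_eq_gibbsWeight hV C hE]
    have hmono : gibbsWeight d N β (fun x => V x + C) E
        ≤ gibbsWeight d N β (fun x => V x + C) (closure E) :=
      lintegral_mono_set (Set.preimage_mono subset_closure)
    have h1 := inv_sq_mul_log_le hN0 ((mul_le_mul_right hmono _).trans hN)
    refine h1.trans (EReal.coe_le_coe_iff.2 (le_of_eq ?_))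
    rw [← hm]
    field_simp
    ring
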